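/- Let s ≥ 3 be a natural number, let m be a natural number, and let A be a finite non-empty subset of S_{3,m}. For every ε > 0 there is a constant C(s, ε) > 0, independent of m and A, such that E_{s,2}(A) ≤ C(s, ε) · m^ε · ( |A|^{(4s−3)/3} · E_{s−1,2}(A)^{1/3} + |A|^{2s−3} ). -/

import Mathlib

open Finset

noncomputable section

/-- The set of lattice points on the sphere of radius `√m` in `ℤ^d`. -/
def latSphere (d m : ℕ) : Set (Fin d → ℤ) := {x | ∑ i, x i ^ 2 = (m : ℤ)}

/-- The additive energy `E_{s,2}(A)`: the number of `2s`-tuples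
`(x₁, …, x_{2s}) ∈ A^{2s}` with `x₁ + ⋯ + x_s = x_{s+1} + ⋯ + x_{2s}`. -/
def addEnergy {V : Type*} [AddCommMonoid V] (s : ℕ) (A : Set V) : ℕ :=
  Nat.card {p : (Fin s → V) × (Fin s → V) //
    (∀ i, p.1 i ∈ A) ∧ (∀ i, p.2 i ∈ A) ∧ ∑ i, p.1 i = ∑ i, p.2 i}

/-- The representation function `r_s(A, n)`: the number of `s`-tuples
`(x₁, …, x_s) ∈ A^s` with `x₁ + ⋯ + x_s = n`. -/
def repCount {V : Type*} [AddCommMonoid V] (s : ℕ) (A : Set V) (n : V) : ℕ :=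
  Nat.card {x : Fin s → V // (∀ i, x i ∈ A) ∧ ∑ i, x i = n}

theorem exp_poly_bound (e : ℕ) : ∃ C : ℕ, 1 ≤ C ∧ ∀ v : ℕ, (v + 1) ^ e ≤ C * 2 ^ v := by
  have h : Filter.Tendsto (fun n : ℕ => (n : ℝ) ^ e / 2 ^ n) Filter.atTop (nhds 0) :=
    tendsto_pow_const_div_const_pow_of_one_lt e (by norm_num)
  have hb := h.bddAbove_range
  obtain ⟨B, hB⟩ := hb
  obtain ⟨C, hC⟩ := exists_nat_ge (2 * B)
  refine ⟨C + 1, by omega, fun v => ?_⟩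
  have h1 : ((v + 1 : ℕ) : ℝ) ^ e / 2 ^ (v + 1) ≤ B := hB ⟨v + 1, rfl⟩
  rw [div_le_iff₀ (by positivity)] at h1
  have h2 : ((v + 1 : ℕ) : ℝ) ^ e ≤ (C + 1) * 2 ^ v := by
    have : B * 2 ^ (v + 1) = (2 * B) * 2 ^ v := by ring
    rw [this] at h1
    have h3 : (2 * B) * (2 : ℝ) ^ v ≤ (C + 1) * 2 ^ v := by
      gcongr; linarith
    linarith
  exact_mod_cast h2

theorem divisor_pow_bound (e : ℕ) : ∃ C : ℕ, 1 ≤ C ∧ ∀ n : ℕ, n ≠ 0 →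
    (#n.divisors) ^ e ≤ C * n := by
  obtain ⟨C, hC1, hC⟩ := exp_poly_bound e
  refine ⟨C ^ (2 ^ e), Nat.one_le_pow _ _ hC1, fun n hn => ?_⟩
  rw [Nat.card_divisors hn, ← Finset.prod_pow]
  have key : ∀ p ∈ n.primeFactors, (n.factorization p + 1) ^ e ≤
      (if p < 2 ^ e then C else 1) * p ^ (n.factorization p) := by
    intro p hp
    have hp2 := (Nat.prime_of_mem_primeFactors hp).two_le
    split_ifs with h
    · exact (hC _).trans (by gcongr)
    · push Not at h
      rw [one_mul]
      calc (n.factorization p + 1) ^ e ≤ (2 ^ n.factorization p) ^ e := by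
            gcongr
            exact Nat.lt_two_pow_self
        _ = (2 ^ e) ^ n.factorization p := by rw [← pow_mul, ← pow_mul, mul_comm]
        _ ≤ p ^ n.factorization p := by gcongr
  refine (Finset.prod_le_prod' key).trans ?_
  rw [Finset.prod_mul_distrib]
  have h2 : ∏ p ∈ n.primeFactors, p ^ n.factorization p = n := by
    exact Nat.prod_factorization_pow_eq_self hn
  rw [h2]
  gcongr
  rw [Finset.prod_ite]
  simp only [prod_const, one_pow, mul_one]
  apply Nat.pow_le_pow_right hC1
  calc #({p ∈ n.primeFactors | p < 2 ^ e}) ≤ #(Finset.range (2 ^ e)) := by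
        apply card_le_card
        intro p hp
        simp at hp ⊢
        exact hp.2
    _ = 2 ^ e := by simp

theorem sqfree_aux {D c : ℕ} (hD : Squarefree D) (h : c * c ∣ 4 * D) : c ∣ 2 := by
  rcases Nat.even_or_odd' c with ⟨k, rfl | rfl⟩
  · have h1 : k * k ∣ D := by
      have : 2 * k * (2 * k) = 4 * (k * k) := by ring
      rw [this] at h
      exact Nat.dvd_of_mul_dvd_mul_left (by norm_num) h
    have := hD k h1
    rw [Nat.isUnit_iff] at this
    subst this
    simp
  · have hc : Nat.Coprime ((2 * k + 1) * (2 * k + 1)) 4 := by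
      have h2 : Nat.Coprime (2 * k + 1) 2 := by simp
      have h4 : Nat.Coprime (2 * k + 1) 4 := by
        have := Nat.Coprime.mul_right h2 h2
        simpa using this
      exact Nat.Coprime.mul_left h4 h4
    have h1 := hc.dvd_of_dvd_mul_left h
    have := hD _ h1
    rw [Nat.isUnit_iff] at this
    rw [this]; simp

/-- number of square roots of `-D` modulo `N` -/
theorem roots_bound {D N : ℕ} (hD : Squarefree D) (hN : 0 < N) :
    #((Finset.range N).filter (fun t : ℕ => (N : ℤ) ∣ (t : ℤ) ^ 2 + (D : ℤ))) ≤ 2 * #N.divisors := by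
  set R := ((Finset.range N).filter (fun t : ℕ => (N : ℤ) ∣ (t : ℤ) ^ 2 + (D : ℤ))) with hR
  rcases R.eq_empty_or_nonempty with h0 | ⟨t0, ht0⟩
  · simp [h0]
  have hmem : ∀ t, t ∈ R ↔ t < N ∧ (N : ℤ) ∣ (t : ℤ) ^ 2 + D := by
    intro t; simp [hR]
  have ht0' := (hmem t0).1 ht0
  have : #R ≤ #(N.divisors ×ˢ (Finset.univ : Finset Bool)) := by
    apply Finset.card_le_card_of_injOn
      (fun t : ℕ => (Int.gcd ((t : ℤ) - t0) N, decide (2 * t < N)))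
    · intro t ht
      simp only [coe_product, coe_univ, Set.mem_prod, Set.mem_univ, and_true, mem_coe,
        Nat.mem_divisors]
      refine ⟨?_, hN.ne'⟩
      have := Int.gcd_dvd_right (a := (t : ℤ) - t0) (b := (N : ℤ))
      exact_mod_cast this
    · intro t ht t' ht' heq
      simp only [Prod.mk.injEq, decide_eq_decide] at heq
      obtain ⟨hg, hlt⟩ := heq
      have h1 := (hmem t).1 ht
      have h2 := (hmem t').1 ht'
      obtain ⟨g, hgdef⟩ : ∃ g : ℕ, g = Int.gcd ((t : ℤ) - t0) N := ⟨_, rfl⟩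
      have hgN : g ∣ N := by
        have := Int.gcd_dvd_right (a := (t : ℤ) - t0) (b := (N : ℤ))
        rw [← hgdef] at this
        exact_mod_cast this
      obtain ⟨h, hh⟩ := hgN
      have hgpos : 0 < g := by
        rcases Nat.eq_zero_or_pos g with h' | h'
        · subst h'; simp at hh; omega
        · exact h'
      have key : ∀ r : ℕ, (N : ℤ) ∣ (r : ℤ) ^ 2 + D → g = Int.gcd ((r : ℤ) - t0) N →
          (g : ℤ) ∣ r - t0 ∧ (h : ℤ) ∣ r + t0 := by
        intro r hr hgr
        refine ⟨?_, ?_⟩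
        · rw [hgr]; exact Int.gcd_dvd_left _ _
        · have hdiv : (N : ℤ) ∣ ((r : ℤ) - t0) * (r + t0) := by
            have := dvd_sub hr ht0'.2
            have h3 : ((r : ℤ) ^ 2 + D) - ((t0 : ℤ) ^ 2 + D) = ((r : ℤ) - t0) * (r + t0) := by ring
            rwa [h3] at this
          have h4 : (N : ℤ) ∣ (Int.gcd ((r : ℤ) - t0) N : ℤ) * (r + t0) := by
            rw [Int.gcd_eq_gcd_ab]
            rw [add_mul]
            apply dvd_add
            · have : ((r : ℤ) - t0) * Int.gcdA ((r : ℤ) - t0) N * (r + t0) =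
                ((r : ℤ) - t0) * (r + t0) * Int.gcdA ((r : ℤ) - t0) N := by ring
              rw [this]; exact hdiv.mul_right _
            · rw [mul_assoc]; exact dvd_mul_right _ _
          rw [← hgr, hh] at h4
          push_cast at h4
          exact Int.dvd_of_mul_dvd_mul_left (by exact_mod_cast hgpos.ne') h4
      have k1 := key t h1.2 hgdef
      have k2 := key t' h2.2 (hgdef.trans hg)
      have k0 : (g : ℤ) ∣ (t : ℤ) - t' ∧ (h : ℤ) ∣ (t : ℤ) - t' := by
        refine ⟨?_, ?_⟩
        · have := dvd_sub k1.1 k2.1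
          simpa using this
        · have := dvd_sub k1.2 k2.2
          simpa using this
      have hlcm : ((Nat.lcm g h : ℕ) : ℤ) ∣ (t : ℤ) - t' := by
        have := Int.coe_lcm_dvd k0.1 k0.2
        simpa [Int.lcm] using this
      have hc : Nat.gcd g h ∣ 2 := by
        apply sqfree_aux hD
        obtain ⟨c, hcdef⟩ : ∃ c : ℕ, c = Nat.gcd g h := ⟨_, rfl⟩
        rw [← hcdef]
        have c1 : (c : ℤ) ∣ g := by rw [hcdef]; exact_mod_cast Nat.gcd_dvd_left g h
        have c2 : (c : ℤ) ∣ h := by rw [hcdef]; exact_mod_cast Nat.gcd_dvd_right g h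
        have c3 : (c : ℤ) ∣ 2 * t := by
          have := dvd_add (c1.trans k1.1) (c2.trans k1.2)
          have h5 : (t : ℤ) - t0 + (t + t0) = 2 * t := by ring
          rwa [h5] at this
        have c4 : (c : ℤ) * c ∣ (t : ℤ) ^ 2 + D := by
          refine dvd_trans ?_ h1.2
          rw [hh]; push_cast
          exact mul_dvd_mul c1 c2
        have c5 : (c : ℤ) * c ∣ 4 * D := by
          have h6 := dvd_sub (c4.mul_left 4) (mul_dvd_mul c3 c3)
          have h7 : 4 * ((t : ℤ) ^ 2 + D) - 2 * t * (2 * t) = 4 * D := by ring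
          rwa [h7] at h6
        exact_mod_cast c5
      have hN2 : (N : ℤ) ∣ 2 * ((t : ℤ) - t') := by
        have : N = Nat.gcd g h * Nat.lcm g h := by rw [Nat.gcd_mul_lcm, hh]
        rw [this]; push_cast
        apply mul_dvd_mul
        · exact_mod_cast hc
        · exact hlcm
      have l1 := h1.1
      have l2 := h2.1
      obtain ⟨q, hq⟩ := hN2
      have hNz : (0 : ℤ) < N := by exact_mod_cast hN
      have hlt1 : 2 * ((t : ℤ) - t') < N := by
        by_cases hx : 2 * t < N
        · omega
        · have := mt hlt.2 hx
          omega
      have hlt2 : -(N : ℤ) < 2 * ((t : ℤ) - t') := by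
        by_cases hx : 2 * t < N
        · have := hlt.1 hx
          omega
        · omega
      have q0 : q = 0 := by
        have a1 : q < 1 := by
          by_contra hcon
          push Not at hcon
          nlinarith
        have a2 : -1 < q := by
          by_contra hcon
          push Not at hcon
          nlinarith
        omega
      subst q0
      omega
  refine this.trans ?_
  simp [card_product, mul_comm]

/-- primitive solutions of `X² + D Y² = N` -/
theorem prim_bound {D N : ℕ} (hD : Squarefree D) (hN : 0 < N) (S : Finset (ℤ × ℤ))
    (hS : ∀ z ∈ S, z.1 ^ 2 + D * z.2 ^ 2 = N ∧ IsCoprime z.1 z.2) :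
    #S ≤ 18 * #N.divisors := by
  have hD0 : 0 < D := Nat.pos_of_ne_zero hD.ne_zero
  have hex : ∀ z ∈ S, ∃ t : ℕ, t < N ∧ (N : ℤ) ∣ (t : ℤ) ^ 2 + D ∧ (N : ℤ) ∣ z.1 - t * z.2 := by
    intro z hz
    obtain ⟨he, hc⟩ := hS z hz
    have hcY : IsCoprime z.2 (N : ℤ) := by
      rw [← he]
      have : IsCoprime z.2 (z.1 ^ 2) := (hc.symm).pow_right
      have h2 := IsCoprime.add_mul_left_right this ((D : ℤ) * z.2)
      have h3 : z.1 ^ 2 + z.2 * ((D : ℤ) * z.2) = z.1 ^ 2 + D * z.2 ^ 2 := by ring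
      rwa [h3] at h2
    obtain ⟨a, b, hab⟩ := hcY
    have hNz : (0 : ℤ) < N := by exact_mod_cast hN
    have hnn := Int.emod_nonneg (z.1 * a) hNz.ne'
    have hlt := Int.emod_lt_of_pos (z.1 * a) hNz
    refine ⟨((z.1 * a) % N).toNat, ?_, ?_⟩
    · zify; rw [Int.toNat_of_nonneg hnn]; exact hlt
    · rw [Int.toNat_of_nonneg hnn]
      have hd : (N : ℤ) ∣ z.1 * a - (z.1 * a) % N := Int.dvd_self_sub_emod
      obtain ⟨r, hr⟩ := hd
      have hr' : (z.1 * a) % N = z.1 * a - N * r := by linarith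
      rw [hr']
      have h3 : (N : ℤ) ∣ z.1 - (z.1 * a - N * r) * z.2 := by
        refine ⟨z.1 * b + r * z.2, ?_⟩
        linear_combination (-z.1) * hab
      refine ⟨?_, h3⟩
      set t := z.1 * a - N * r with ht
      -- z.2^2 (t^2 + D) ≡ z.1^2 + D z.2^2
      have h4 : (N : ℤ) ∣ z.2 ^ 2 * (t ^ 2 + D) := by
        obtain ⟨w, hw⟩ := h3
        refine ⟨1 - w * (z.1 + t * z.2), ?_⟩
        linear_combination he - (z.1 + t * z.2) * hw
      have hcop : IsCoprime (N : ℤ) (z.2 ^ 2) := by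
        have : IsCoprime z.2 (N : ℤ) := ⟨a, b, hab⟩
        exact this.symm.pow_right
      exact hcop.dvd_of_dvd_mul_left h4
  choose! t ht using hex
  have himg : ∀ z ∈ S, t z ∈ (((Finset.range N).filter (fun t : ℕ => (N : ℤ) ∣ (t : ℤ) ^ 2 + (D : ℤ)))) := by
    intro z hz
    simp only [mem_filter, mem_range]
    exact ⟨(ht z hz).1, (ht z hz).2.1⟩
  have := Finset.card_le_mul_card_image_of_maps_to himg 9 (by
    intro b hb
    set Fb := {z ∈ S | t z = b} with hFb
    rcases Fb.eq_empty_or_nonempty with h0 | ⟨z0, hz0⟩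
    · simp [h0]
    have hz0' : z0 ∈ S ∧ t z0 = b := by simpa [hFb] using hz0
    have hNz : (0 : ℤ) < N := by exact_mod_cast hN
    have e0 := (hS z0 hz0'.1).1
    have d0 := (ht z0 hz0'.1).2.2
    have db := (ht z0 hz0'.1).2.1
    rw [hz0'.2] at d0 db
    have hkey : ∀ z ∈ Fb, ∃ e c : ℤ, z0.1 * z.1 + D * z0.2 * z.2 = N * e ∧
        z0.1 * z.2 - z.1 * z0.2 = N * c ∧ e ^ 2 + D * c ^ 2 = 1 := by
      intro z hz
      have hz' : z ∈ S ∧ t z = b := by simpa [hFb] using hz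
      have e1 := (hS z hz'.1).1
      have d1 := (ht z hz'.1).2.2
      rw [hz'.2] at d1
      obtain ⟨u, hu⟩ := d0
      obtain ⟨v, hv⟩ := d1
      obtain ⟨w, hw⟩ := db
      have f1 : z0.1 * z.1 + D * z0.2 * z.2 = N * (u * z.1 + b * z0.2 * v + w * z0.2 * z.2) := by
        linear_combination z.1 * hu + b * z0.2 * hv + z0.2 * z.2 * hw
      have f2 : z0.1 * z.2 - z.1 * z0.2 = N * (u * z.2 - v * z0.2) := by
        linear_combination z.2 * hu - z0.2 * hv
      refine ⟨_, _, f1, f2, ?_⟩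
      set e := u * z.1 + b * z0.2 * v + w * z0.2 * z.2
      set c := u * z.2 - v * z0.2
      have f3 : (N : ℤ) ^ 2 * (e ^ 2 + D * c ^ 2) = N ^ 2 * 1 := by
        have : (N : ℤ) ^ 2 * (e ^ 2 + D * c ^ 2) =
          (z0.1 * z.1 + D * z0.2 * z.2) ^ 2 + D * (z0.1 * z.2 - z.1 * z0.2) ^ 2 := by
          rw [f1, f2]; ring
        rw [this]
        have h8 : (z0.1 * z.1 + D * z0.2 * z.2) ^ 2 + D * (z0.1 * z.2 - z.1 * z0.2) ^ 2 =
          (z0.1 ^ 2 + D * z0.2 ^ 2) * (z.1 ^ 2 + D * z.2 ^ 2) := by ring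
        rw [h8, e0, e1]; ring
      exact mul_left_cancel₀ (pow_ne_zero 2 hNz.ne') f3
    choose! e c hec using hkey
    have hDz : (1 : ℤ) ≤ D := by exact_mod_cast hD0
    have : #Fb ≤ #((Finset.Icc (-1 : ℤ) 1) ×ˢ (Finset.Icc (-1 : ℤ) 1)) := by
      apply Finset.card_le_card_of_injOn (fun z => (e z, c z))
      · intro z hz
        obtain ⟨_, _, h3⟩ := hec z hz
        simp only [coe_product, coe_Icc, Set.mem_prod, Set.mem_Icc]
        refine ⟨⟨?_, ?_⟩, ⟨?_, ?_⟩⟩ <;> nlinarith [sq_nonneg (e z), sq_nonneg (c z)]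
      · intro z hz z' hz' heq
        simp only [Prod.mk.injEq] at heq
        obtain ⟨a1, a2, _⟩ := hec z hz
        obtain ⟨b1, b2, _⟩ := hec z' hz'
        rw [← heq.1] at b1
        rw [← heq.2] at b2
        have g1 : (N : ℤ) * z.1 = N * z'.1 := by
          rw [← e0]
          linear_combination z0.1 * a1 - D * z0.2 * a2 - z0.1 * b1 + D * z0.2 * b2
        have g2 : (N : ℤ) * z.2 = N * z'.2 := by
          rw [← e0]
          linear_combination z0.2 * a1 + z0.1 * a2 - z0.2 * b1 - z0.1 * b2
        exact Prod.ext (mul_left_cancel₀ hNz.ne' g1) (mul_left_cancel₀ hNz.ne' g2)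
    refine this.trans ?_
    decide)
  refine this.trans ?_
  have := roots_bound hD hN
  omega

/-- all solutions of `X² + D Y² = N` -/
theorem quad_bound {D N : ℕ} (hD : 0 < D) (hN : 0 < N) (S : Finset (ℤ × ℤ))
    (hS : ∀ z ∈ S, z.1 ^ 2 + D * z.2 ^ 2 = N) :
    #S ≤ 18 * (#N.divisors) ^ 2 := by
  -- squarefree case first
  have main : ∀ (D : ℕ), Squarefree D → ∀ (S : Finset (ℤ × ℤ)),
      (∀ z ∈ S, z.1 ^ 2 + D * z.2 ^ 2 = N) → #S ≤ 18 * (#N.divisors) ^ 2 := by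
    intro D hD S hS
    have hgz : ∀ z ∈ S, 0 < Int.gcd z.1 z.2 := by
      intro z hz
      rw [Nat.pos_iff_ne_zero]
      intro h0
      rw [Int.gcd_eq_zero_iff] at h0
      have := hS z hz
      rw [h0.1, h0.2] at this
      simp at this
      omega
    have hsq : ∀ z ∈ S, ∃ a b : ℤ, z.1 = Int.gcd z.1 z.2 * a ∧ z.2 = Int.gcd z.1 z.2 * b ∧
        IsCoprime a b := by
      intro z hz
      obtain ⟨a, b, h1, h2, h3⟩ := Int.exists_gcd_one (hgz z hz)
      exact ⟨a, b, by rw [mul_comm]; exact h2, by rw [mul_comm]; exact h3,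
        Int.isCoprime_iff_gcd_eq_one.2 h1⟩
    choose! a b ha hb hab using hsq
    have himg : ∀ z ∈ S, Int.gcd z.1 z.2 ∈ N.divisors := by
      intro z hz
      rw [Nat.mem_divisors]
      refine ⟨?_, hN.ne'⟩
      have h1 : ((Int.gcd z.1 z.2 : ℕ) : ℤ) ∣ z.1 := Int.gcd_dvd_left _ _
      have h2 : ((Int.gcd z.1 z.2 : ℕ) : ℤ) ∣ z.2 := Int.gcd_dvd_right _ _
      have : ((Int.gcd z.1 z.2 : ℕ) : ℤ) ∣ (N : ℤ) := by
        rw [← hS z hz]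
        exact dvd_add (dvd_pow h1 two_ne_zero) ((dvd_pow h2 two_ne_zero).mul_left _)
      exact_mod_cast this
    have := Finset.card_le_mul_card_image_of_maps_to himg (18 * #N.divisors) (by
      intro g hg
      set Fg := {z ∈ S | Int.gcd z.1 z.2 = g} with hFg
      rcases Fg.eq_empty_or_nonempty with h0 | ⟨z0, hz0⟩
      · simp [h0]
      have hm : ∀ z ∈ Fg, z ∈ S ∧ Int.gcd z.1 z.2 = g := by
        intro z hz; simpa [hFg] using hz
      have hgpos : 0 < g := by
        have := hgz z0 (hm z0 hz0).1
        rwa [(hm z0 hz0).2] at this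
      have hgz' : (g : ℤ) ≠ 0 := by exact_mod_cast hgpos.ne'
      have heq : ∀ z ∈ Fg, (N : ℤ) = (g : ℤ) ^ 2 * ((a z) ^ 2 + D * (b z) ^ 2) := by
        intro z hz
        have h1 := ha z (hm z hz).1
        have h2 := hb z (hm z hz).1
        rw [(hm z hz).2] at h1 h2
        rw [← hS z (hm z hz).1, h1, h2]; ring
      have hgN : g ^ 2 ∣ N := by
        have : ((g ^ 2 : ℕ) : ℤ) ∣ (N : ℤ) := by
          rw [heq z0 hz0]; push_cast; exact dvd_mul_right _ _
        exact_mod_cast this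
      obtain ⟨N', hN'⟩ := hgN
      have hN'pos : 0 < N' := by
        rcases Nat.eq_zero_or_pos N' with h | h
        · subst h; simp at hN'; omega
        · exact h
      have hinj : Set.InjOn (fun z => (a z, b z)) (Fg : Set (ℤ × ℤ)) := by
        intro z hz z' hz' h
        simp only [Prod.mk.injEq] at h
        have h1 := ha z (hm z hz).1
        have h2 := hb z (hm z hz).1
        have h3 := ha z' (hm z' hz').1
        have h4 := hb z' (hm z' hz').1
        rw [(hm z hz).2] at h1 h2
        rw [(hm z' hz').2] at h3 h4
        apply Prod.ext
        · rw [h1, h3, h.1]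
        · rw [h2, h4, h.2]
      have hp := prim_bound hD hN'pos (Fg.image (fun z => (a z, b z))) (by
        intro w hw
        rw [Finset.mem_image] at hw
        obtain ⟨z, hz, rfl⟩ := hw
        refine ⟨?_, hab z (hm z hz).1⟩
        have h1 := heq z hz
        rw [hN'] at h1
        push_cast at h1
        exact (mul_left_cancel₀ (pow_ne_zero 2 hgz') h1).symm)
      rw [Finset.card_image_of_injOn hinj] at hp
      refine hp.trans ?_
      gcongr
      exact ⟨g ^ 2, by rw [hN']; ring⟩)
    refine this.trans (le_of_eq ?_)
    ring
  obtain ⟨a, b, hab, hsf⟩ := Nat.sq_mul_squarefree D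
  have hb : (b : ℤ) ≠ 0 := by
    have : b ≠ 0 := by
      rintro rfl
      simp at hab; omega
    exact_mod_cast this
  have hinj : Set.InjOn (fun z : ℤ × ℤ => (z.1, (b : ℤ) * z.2)) (S : Set (ℤ × ℤ)) := by
    intro z _ z' _ h
    simp only [Prod.mk.injEq] at h
    exact Prod.ext h.1 (mul_left_cancel₀ hb h.2)
  have := main a hsf (S.image (fun z : ℤ × ℤ => (z.1, (b : ℤ) * z.2))) (by
    intro w hw
    rw [Finset.mem_image] at hw
    obtain ⟨z, hz, rfl⟩ := hw
    rw [← hS z hz, ← hab]; push_cast; ring)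
  rwa [Finset.card_image_of_injOn hinj] at this

theorem divisor_rpow_bound (δ : ℝ) (hδ : 0 < δ) : ∃ C : ℝ, 1 ≤ C ∧ ∀ n : ℕ, n ≠ 0 →
    (#n.divisors : ℝ) ≤ C * (n : ℝ) ^ δ := by
  obtain ⟨e, he⟩ := exists_nat_gt (1 / δ)
  have he0 : (0 : ℝ) < e := lt_trans (by positivity) he
  have he0' : e ≠ 0 := by rintro rfl; simp at he0
  obtain ⟨C, hC1, hC⟩ := divisor_pow_bound e
  refine ⟨C, by exact_mod_cast hC1, fun n hn => ?_⟩
  have hn1 : (1 : ℝ) ≤ n := by exact_mod_cast Nat.one_le_iff_ne_zero.2 hn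
  have hC1' : (1 : ℝ) ≤ C := by exact_mod_cast hC1
  have h1 : (#n.divisors : ℝ) ^ e ≤ C * n := by exact_mod_cast hC n hn
  have h2 : (C * n : ℝ) ≤ (C * (n : ℝ) ^ δ) ^ e := by
    rw [mul_pow]
    gcongr
    · exact le_self_pow₀ hC1' he0'
    · rw [← Real.rpow_natCast, ← Real.rpow_mul (by positivity)]
      have : 1 ≤ δ * e := by
        rw [div_lt_iff₀ hδ] at he; linarith
      calc (n : ℝ) = (n : ℝ) ^ (1 : ℝ) := by simp
        _ ≤ _ := Real.rpow_le_rpow_of_exponent_le hn1 this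
  exact le_of_pow_le_pow_left₀ he0' (by positivity) (h1.trans h2)

theorem circle_scalar (d1 d2 d3 M : ℤ) (h3 : d3 ≠ 0) (hM : 0 < M) (S : Finset (ℤ × ℤ × ℤ))
    (hS : ∀ c ∈ S, c.1 * d1 + c.2.1 * d2 + c.2.2 * d3 = 0 ∧
      c.1 ^ 2 + c.2.1 ^ 2 + c.2.2 ^ 2 = M) :
    #S ≤ 18 * (#((d1 ^ 2 + d3 ^ 2) * M * d3 ^ 2).toNat.divisors) ^ 2 := by
  have hα : 0 < d1 ^ 2 + d3 ^ 2 := by positivity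
  have hNpos : 0 < (d1 ^ 2 + d3 ^ 2) * M * d3 ^ 2 := by positivity
  have hDpos : 0 < d1 ^ 2 + d2 ^ 2 + d3 ^ 2 := by positivity
  set N := ((d1 ^ 2 + d3 ^ 2) * M * d3 ^ 2).toNat with hN
  have hNz : (N : ℤ) = (d1 ^ 2 + d3 ^ 2) * M * d3 ^ 2 := Int.toNat_of_nonneg hNpos.le
  have hDz : ((d1 ^ 2 + d2 ^ 2 + d3 ^ 2).toNat : ℤ) = d1 ^ 2 + d2 ^ 2 + d3 ^ 2 :=
    Int.toNat_of_nonneg hDpos.le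
  have hinj : Set.InjOn (fun c : ℤ × ℤ × ℤ => ((d1 ^ 2 + d3 ^ 2) * c.1 + d1 * d2 * c.2.1,
      d3 * c.2.1)) (S : Set (ℤ × ℤ × ℤ)) := by
    intro c hc c' hc' h
    simp only [Prod.mk.injEq] at h
    obtain ⟨e1, e2⟩ := h
    have f2 := mul_left_cancel₀ h3 e2
    rw [f2] at e1
    have f1 : c.1 = c'.1 := mul_left_cancel₀ hα.ne' (by linarith)
    have g := (hS c hc).1
    have g' := (hS c' hc').1
    rw [f1, f2] at g
    have f3 : c.2.2 = c'.2.2 := mul_right_cancel₀ h3 (by linarith)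
    exact Prod.ext f1 (Prod.ext f2 f3)
  rw [← Finset.card_image_of_injOn hinj]
  apply quad_bound (D := (d1 ^ 2 + d2 ^ 2 + d3 ^ 2).toNat) (by omega) (by omega)
  intro z hz
  rw [Finset.mem_image] at hz
  obtain ⟨c, hc, rfl⟩ := hz
  obtain ⟨g1, g2⟩ := hS c hc
  simp only
  rw [hNz, hDz, ← g2]
  linear_combination (d1 ^ 2 + d3 ^ 2) * (d1 * c.1 + c.2.1 * d2 - c.2.2 * d3) * g1

theorem circle_bound (δ : ℝ) (hδ : 0 < δ) : ∃ C : ℝ, 1 ≤ C ∧ ∀ m : ℕ, 0 < m →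
    ∀ d : Fin 3 → ℤ, d ≠ 0 → ∀ F : Finset (Fin 3 → ℤ), (∀ a ∈ F, ∑ i, a i ^ 2 = (m : ℤ)) →
    ((#{a ∈ F | a - d ∈ F} : ℕ) : ℝ) ≤ C * (m : ℝ) ^ δ := by
  obtain ⟨C, hC1, hC⟩ := divisor_rpow_bound (δ / 6) (by positivity)
  have hC18 : 1 ≤ 18 * (C * 64 ^ (δ / 6)) ^ 2 := by
    have : (1 : ℝ) ≤ 64 ^ (δ / 6) := Real.one_le_rpow (by norm_num) (by positivity)
    have h2 : (1 : ℝ) ≤ C * 64 ^ (δ / 6) := by nlinarith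
    nlinarith
  refine ⟨18 * (C * 64 ^ (δ / 6)) ^ 2, hC18, ?_⟩
  intro m hm d hd F hF
  set S := {a ∈ F | a - d ∈ F} with hSdef
  have hm1 : (1 : ℝ) ≤ m := by exact_mod_cast hm
  have hmem : ∀ a ∈ S, ∑ i, a i ^ 2 = (m : ℤ) ∧ ∑ i, (a - d) i ^ 2 = (m : ℤ) := by
    intro a ha
    simp only [hSdef, mem_filter] at ha
    exact ⟨hF _ ha.1, hF _ ha.2⟩
  have hrhs : 1 ≤ 18 * (C * 64 ^ (δ / 6)) ^ 2 * (m : ℝ) ^ δ := by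
    have : 1 ≤ (m : ℝ) ^ δ := Real.one_le_rpow hm1 hδ.le
    nlinarith
  obtain ⟨i, hi⟩ : ∃ i, d i ≠ 0 := by
    by_contra h
    push Not at h
    exact hd (funext h)
  set M : ℤ := 4 * m - ∑ i, d i ^ 2 with hM
  have hc : ∀ a ∈ S, (2 * a (i + 1) - d (i + 1)) * d (i + 1) + (2 * a (i + 2) - d (i + 2)) * d (i + 2)
      + (2 * a i - d i) * d i = 0 ∧ (2 * a (i + 1) - d (i + 1)) ^ 2 +
      (2 * a (i + 2) - d (i + 2)) ^ 2 + (2 * a i - d i) ^ 2 = M := by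
    intro a ha
    obtain ⟨h1, h2⟩ := hmem a ha
    rw [hM]
    simp only [Fin.sum_univ_three, Pi.sub_apply] at h1 h2 ⊢
    fin_cases i <;> simp <;> constructor <;> linarith
  rcases lt_or_ge 0 M with hMp | hM0
  · have hinj : Set.InjOn (fun a : Fin 3 → ℤ => (2 * a (i + 1) - d (i + 1),
        2 * a (i + 2) - d (i + 2), 2 * a i - d i)) (S : Set (Fin 3 → ℤ)) := by
      intro a _ a' _ h
      simp only [Prod.mk.injEq] at h
      obtain ⟨e1, e2, e3⟩ := h
      funext j
      fin_cases i <;> fin_cases j <;> simp at * <;> omega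
    have hb := circle_scalar (d (i + 1)) (d (i + 2)) (d i) M hi hMp
      (S.image (fun a : Fin 3 → ℤ => (2 * a (i + 1) - d (i + 1),
        2 * a (i + 2) - d (i + 2), 2 * a i - d i))) (by
        intro c hc'
        rw [Finset.mem_image] at hc'
        obtain ⟨a, ha, rfl⟩ := hc'
        exact hc a ha)
    rw [Finset.card_image_of_injOn hinj] at hb
    set N := ((d (i + 1) ^ 2 + d i ^ 2) * M * d i ^ 2).toNat with hN
    have hsum : ∑ i, d i ^ 2 = d (i + 1) ^ 2 + d (i + 2) ^ 2 + d i ^ 2 := by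
      rw [Fin.sum_univ_three]
      fin_cases i <;> simp <;> ring
    have hNpos : 0 < (d (i + 1) ^ 2 + d i ^ 2) * M * d i ^ 2 := by positivity
    have hNz : (N : ℤ) = (d (i + 1) ^ 2 + d i ^ 2) * M * d i ^ 2 := Int.toNat_of_nonneg hNpos.le
    have hle : (N : ℤ) ≤ 64 * (m : ℤ) ^ 3 := by
      rw [hNz]
      have a1 : d (i + 1) ^ 2 + d i ^ 2 ≤ 4 * m := by nlinarith [sq_nonneg (d (i + 2))]
      have a2 : M ≤ 4 * m := by
        rw [hM, hsum]; nlinarith [sq_nonneg (d (i + 2)), sq_nonneg (d (i + 1)), sq_nonneg (d i)]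
      have a3 : d i ^ 2 ≤ 4 * m := by nlinarith [sq_nonneg (d (i + 1))]
      calc (d (i + 1) ^ 2 + d i ^ 2) * M * d i ^ 2 ≤ (4 * m) * (4 * m) * (4 * m) := by gcongr
        _ = _ := by ring
    have hleR : (N : ℝ) ≤ 64 * (m : ℝ) ^ 3 := by exact_mod_cast hle
    have hdv := hC N (by omega)
    have h6 : (N : ℝ) ^ (δ / 6) ≤ 64 ^ (δ / 6) * (m : ℝ) ^ (δ / 2) := by
      calc (N : ℝ) ^ (δ / 6) ≤ (64 * (m : ℝ) ^ 3) ^ (δ / 6) := by gcongr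
        _ = _ := by
          rw [Real.mul_rpow (by norm_num) (by positivity), ← Real.rpow_natCast,
            ← Real.rpow_mul (by positivity)]
          congr 2; push_cast; ring
    have hhalf : ((m : ℝ) ^ (δ / 2)) ^ 2 = (m : ℝ) ^ δ := by
      rw [← Real.rpow_natCast, ← Real.rpow_mul (by positivity)]
      congr 1; push_cast; ring
    calc ((#S : ℕ) : ℝ) ≤ 18 * (#N.divisors : ℝ) ^ 2 := by exact_mod_cast hb
      _ ≤ 18 * (C * (64 ^ (δ / 6) * (m : ℝ) ^ (δ / 2))) ^ 2 := by
        gcongr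
        exact hdv.trans (by gcongr)
      _ = 18 * (C * 64 ^ (δ / 6)) ^ 2 * ((m : ℝ) ^ (δ / 2)) ^ 2 := by ring
      _ = _ := by rw [hhalf]
  · have h1 : #S ≤ 1 := by
      rw [Finset.card_le_one]
      intro a ha b hb
      have k : ∀ a ∈ S, 2 * a (i + 1) - d (i + 1) = 0 ∧ 2 * a (i + 2) - d (i + 2) = 0 ∧
          2 * a i - d i = 0 := by
        intro a ha
        have := (hc a ha).2
        refine ⟨?_, ?_, ?_⟩ <;> apply pow_eq_zero_iff (two_ne_zero) |>.1 <;>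
        nlinarith [sq_nonneg (2 * a (i + 1) - d (i + 1)), sq_nonneg (2 * a (i + 2) - d (i + 2)),
          sq_nonneg (2 * a i - d i)]
      have ka := k a ha
      have kb := k b hb
      funext j
      fin_cases i <;> fin_cases j <;> simp at * <;> omega
    have : ((#S : ℕ) : ℝ) ≤ 1 := by exact_mod_cast h1
    linarith

/-- number of pairs with `f z = g z'` -/
def prs {α β γ : Type*} [DecidableEq γ] (S : Finset α) (S' : Finset β) (f : α → γ) (g : β → γ) : ℕ :=
  #{p ∈ S ×ˢ S' | f p.1 = g p.2}

theorem prs_eq_sum {α β γ : Type*} [DecidableEq γ] (S : Finset α) (S' : Finset β)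
    (f : α → γ) (g : β → γ) (T : Finset γ) (hT : ∀ z ∈ S, f z ∈ T) :
    prs S S' f g = ∑ v ∈ T, #{z ∈ S | f z = v} * #{z ∈ S' | g z = v} := by
  unfold prs
  rw [Finset.card_eq_sum_card_fiberwise (f := fun p => f p.1) (t := T)]
  · apply Finset.sum_congr rfl
    intro v _
    rw [← card_product]
    congr 1
    ext p
    simp only [mem_filter, mem_product]
    constructor
    · rintro ⟨⟨⟨h1, h2⟩, h3⟩, h4⟩
      exact ⟨⟨h1, h4⟩, h2, by rw [← h3, h4]⟩
    · rintro ⟨⟨h1, h4⟩, h2, h5⟩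
      exact ⟨⟨⟨h1, h2⟩, by rw [h4, h5]⟩, h4⟩
  · intro p hp
    simp only [coe_filter, mem_product, Set.mem_ofPred_eq] at hp
    exact hT _ hp.1.1

theorem prs_cs {α β γ : Type*} [DecidableEq γ] (S : Finset α) (S' : Finset β)
    (f : α → γ) (g : β → γ) : (prs S S' f g) ^ 2 ≤ prs S S f f * prs S' S' g g := by
  classical
  set T := S.image f ∪ S'.image g
  have h1 : ∀ z ∈ S, f z ∈ T := fun z hz => mem_union_left _ (mem_image_of_mem _ hz)
  have h2 : ∀ z ∈ S', g z ∈ T := fun z hz => mem_union_right _ (mem_image_of_mem _ hz)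
  rw [prs_eq_sum S S' f g T h1, prs_eq_sum S S f f T h1, prs_eq_sum S' S' g g T h2]
  have := Finset.sum_mul_sq_le_sq_mul_sq T (fun v => #{z ∈ S | f z = v}) (fun v => #{z ∈ S' | g z = v})
  simpa [sq] using this

theorem prs_cs_real {α β γ : Type*} [DecidableEq γ] (S : Finset α) (S' : Finset β)
    (f : α → γ) (g : β → γ) :
    (prs S S' f g : ℝ) ≤ Real.sqrt (prs S S f f) * Real.sqrt (prs S' S' g g) := by
  rw [← Real.sqrt_mul (by positivity)]
  apply Real.le_sqrt_of_sq_le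
  exact_mod_cast prs_cs S S' f g

theorem prs_color {α γ κ : Type*} [DecidableEq γ] [DecidableEq κ] (S : Finset α)
    (f : α → γ) (c : α → κ) (T : Finset κ) (hT : ∀ z ∈ S, c z ∈ T) :
    prs S S f f ≤ #T * #{p ∈ S ×ˢ S | f p.1 = f p.2 ∧ c p.1 = c p.2} := by
  classical
  have h1 : ∀ z ∈ S, f z ∈ S.image f := fun z hz => mem_image_of_mem _ hz
  have h2 : ∀ z ∈ S, (fun z => (f z, c z)) z ∈ (S.image f) ×ˢ T :=
    fun z hz => mem_product.2 ⟨h1 z hz, hT z hz⟩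
  have h3 : #{p ∈ S ×ˢ S | f p.1 = f p.2 ∧ c p.1 = c p.2} =
      prs S S (fun z => (f z, c z)) (fun z => (f z, c z)) := by
    unfold prs; simp [Prod.mk.injEq]
  rw [h3, prs_eq_sum S S _ _ _ h1, prs_eq_sum S S _ _ _ h2, Finset.sum_product, Finset.mul_sum]
  apply Finset.sum_le_sum
  intro v _
  have h4 : #{z ∈ S | f z = v} = ∑ k ∈ T, #{z ∈ S | (f z, c z) = (v, k)} := by
    rw [Finset.card_eq_sum_card_fiberwise (f := c) (t := T)]
    · apply Finset.sum_congr rfl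
      intro k _
      rw [filter_filter]
      simp [Prod.mk.injEq]
    · intro z hz
      simp only [coe_filter, Set.mem_ofPred_eq] at hz
      exact hT _ hz.1
  rw [h4]
  have := sq_sum_le_card_mul_sum_sq (s := T) (f := fun k => #{z ∈ S | (f z, c z) = (v, k)})
  simpa [sq] using this

set_option linter.unusedSectionVars false

section energy
variable {V : Type*} [AddCommGroup V] [DecidableEq V]

/-- tuples in `F` -/
def tup (t : ℕ) (F : Finset V) : Finset (Fin t → V) := Fintype.piFinset (fun _ => F)

theorem mem_tup {t : ℕ} {F : Finset V} {X : Fin t → V} : X ∈ tup t F ↔ ∀ i, X i ∈ F := by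
  simp [tup]

theorem card_tup (t : ℕ) (F : Finset V) : #(tup t F) = #F ^ t := by
  simp [tup, Fintype.card_piFinset]

/-- remove a coordinate -/
def rmv {t : ℕ} (i : Fin (t + 1)) (X : Fin (t + 1) → V) : Fin t → V := fun l => X (i.succAbove l)

theorem rmv_ext {t : ℕ} (i : Fin (t + 1)) {X Y : Fin (t + 1) → V} (h : rmv i X = rmv i Y)
    (h' : X i = Y i) : X = Y := by
  funext l
  rcases Fin.eq_self_or_eq_succAbove i l with rfl | ⟨j, rfl⟩
  · exact h'
  · exact congrFun h j

/-- finset version of additive energy -/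
def en (t : ℕ) (F : Finset V) : ℕ :=
  prs (tup t F) (tup t F) (fun X => ∑ i, X i) (fun X => ∑ i, X i)

theorem en_shift (t : ℕ) (F : Finset V) (c : V) :
    prs (tup t F) (tup t F) (fun X => ∑ i, X i + c) (fun X => ∑ i, X i + c) = en t F := by
  unfold en prs
  simp

theorem en_fix_coord (t : ℕ) (F : Finset V) (i : Fin (t + 1)) :
    #{p ∈ tup (t + 1) F ×ˢ tup (t + 1) F | ∑ l, p.1 l = ∑ l, p.2 l ∧ p.1 i = p.2 i}
      ≤ #F * en t F := by
  unfold en prs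
  rw [← card_product]
  apply Finset.card_le_card_of_injOn (fun p : (Fin (t + 1) → V) × (Fin (t + 1) → V) => (p.1 i, (rmv i p.1, rmv i p.2)))
  · intro p hp
    simp only [coe_filter, mem_product, Set.mem_ofPred_eq, mem_tup] at hp
    obtain ⟨⟨h1, h2⟩, h3, h4⟩ := hp
    simp only [coe_product, coe_filter, Set.mem_prod, mem_coe, Set.mem_ofPred_eq, mem_product,
      mem_tup, rmv]
    refine ⟨h1 i, ⟨fun l => h1 _, fun l => h2 _⟩, ?_⟩
    rw [Fin.sum_univ_succAbove _ i, Fin.sum_univ_succAbove _ i, h4] at h3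
    exact add_left_cancel h3
  · intro p hp q hq h
    simp only [coe_filter, mem_product, Set.mem_ofPred_eq, mem_tup] at hp hq
    simp only [Prod.mk.injEq] at h
    obtain ⟨h1, h2, h3⟩ := h
    have e1 : p.1 = q.1 := rmv_ext i h2 h1
    have e2 : p.2 = q.2 := rmv_ext i h3 (by rw [← hp.2.2, ← hq.2.2, h1])
    exact Prod.ext e1 e2

theorem en_swap (u : ℕ) (F : Finset V) :
    prs (tup u F ×ˢ F) (tup u F ×ˢ F) (fun z => ∑ i, z.1 i - z.2) (fun z => ∑ i, z.1 i - z.2)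
      ≤ en (u + 1) F := by
  unfold en prs
  apply Finset.card_le_card_of_injOn
    (fun p => ((Fin.cons p.2.2 p.1.1 : Fin (u + 1) → V), (Fin.cons p.1.2 p.2.1 : Fin (u + 1) → V)))
  · intro p hp
    simp only [coe_filter, mem_product, Set.mem_ofPred_eq, mem_tup] at hp
    obtain ⟨⟨⟨h1, h2⟩, h3, h4⟩, h5⟩ := hp
    simp only [coe_filter, mem_product, Set.mem_ofPred_eq, mem_tup]
    refine ⟨⟨fun l => ?_, fun l => ?_⟩, ?_⟩
    · refine Fin.cases ?_ (fun l => ?_) l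
      · simpa using h4
      · simpa using h1 l
    · refine Fin.cases ?_ (fun l => ?_) l
      · simpa using h2
      · simpa using h3 l
    · simp only [Fin.sum_univ_succ, Fin.cons_zero, Fin.cons_succ]
      rw [sub_eq_sub_iff_add_eq_add] at h5
      rw [add_comm, h5, add_comm]
  · intro p _ q _ h
    simp only [Prod.mk.injEq, Fin.cons_inj] at h
    obtain ⟨⟨h1, h2⟩, h3, h4⟩ := h
    exact Prod.ext (Prod.ext h2 h3) (Prod.ext h4 h1)

theorem en_two_coord (t : ℕ) (F : Finset V) (i j : Fin (t + 1)) (hij : j ≠ i) (τ : V → V) :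
    #{p ∈ tup (t + 1) F ×ˢ tup (t + 1) F | ∑ l, p.1 l = ∑ l, p.2 l ∧ p.1 j = τ (p.1 i)}
      ≤ #F * en t F := by
  obtain ⟨j', rfl⟩ := Fin.exists_succAbove_eq hij
  obtain ⟨u, rfl⟩ : ∃ u, t = u + 1 := ⟨t - 1, by have := j'.pos; omega⟩
  have key : ∀ a ∈ F, #{p ∈ {p ∈ tup (u + 1 + 1) F ×ˢ tup (u + 1 + 1) F |
      ∑ l, p.1 l = ∑ l, p.2 l ∧ p.1 (i.succAbove j') = τ (p.1 i)} | p.1 i = a} ≤ en (u + 1) F := by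
    intro a ha
    have h1 : #{p ∈ {p ∈ tup (u + 1 + 1) F ×ˢ tup (u + 1 + 1) F |
      ∑ l, p.1 l = ∑ l, p.2 l ∧ p.1 (i.succAbove j') = τ (p.1 i)} | p.1 i = a} ≤
      prs (tup u F ×ˢ F) (tup (u + 1) F) (fun z => ∑ i, z.1 i - z.2)
        (fun Y => ∑ i, Y i + (-(a + τ a))) := by
      unfold prs
      apply Finset.card_le_card_of_injOn
        (fun p : (Fin (u + 1 + 1) → V) × (Fin (u + 1 + 1) → V) =>
          ((rmv j' (rmv i p.1), p.2 0), rmv 0 p.2))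
      · intro p hp
        simp only [coe_filter, mem_filter, mem_product, Set.mem_ofPred_eq, mem_tup] at hp
        obtain ⟨⟨⟨h1, h2⟩, h3, h4⟩, h5⟩ := hp
        simp only [coe_filter, mem_product, Set.mem_ofPred_eq, mem_tup, rmv, Fin.zero_succAbove]
        refine ⟨⟨⟨fun l => h1 _, h2 _⟩, fun l => h2 _⟩, ?_⟩
        rw [Fin.sum_univ_succAbove _ i, Fin.sum_univ_succAbove _ j', h4, h5, Fin.sum_univ_succ] at h3
        rw [sub_eq_iff_eq_add]
        have : ∑ i, p.2 (Fin.succ i) = a + (τ a + ∑ l, p.1 (i.succAbove (j'.succAbove l))) - p.2 0 := by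
          rw [h3]; abel
        rw [this]; abel
      · intro p hp q hq h
        simp only [coe_filter, mem_filter, mem_product, Set.mem_ofPred_eq, mem_tup] at hp hq
        simp only [Prod.mk.injEq] at h
        obtain ⟨⟨h1, h2⟩, h3⟩ := h
        have e1 : rmv i p.1 = rmv i q.1 := rmv_ext j' h1 (by
          simp only [rmv]
          rw [hp.1.2.2, hq.1.2.2, hp.2, hq.2])
        have e2 : p.1 = q.1 := rmv_ext i e1 (by rw [hp.2, hq.2])
        have e3 : p.2 = q.2 := rmv_ext 0 h3 h2
        exact Prod.ext e2 e3
    have h2 := prs_cs (tup u F ×ˢ F) (tup (u + 1) F) (fun z => ∑ i, z.1 i - z.2)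
        (fun Y => ∑ i, Y i + (-(a + τ a)))
    rw [en_shift] at h2
    have h3 := en_swap u F
    refine h1.trans ?_
    have h4 := h2.trans (Nat.mul_le_mul_right _ h3)
    rw [← sq] at h4
    exact (Nat.pow_le_pow_iff_left two_ne_zero).1 h4
  have := Finset.card_le_mul_card_image_of_maps_to (s := {p ∈ tup (u + 1 + 1) F ×ˢ tup (u + 1 + 1) F |
      ∑ l, p.1 l = ∑ l, p.2 l ∧ p.1 (i.succAbove j') = τ (p.1 i)}) (t := F) (f := fun p => p.1 i)
    (by intro p hp
        simp only [mem_filter, mem_product, mem_tup] at hp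
        exact hp.1.1 i) (en (u + 1) F) key
  rw [mul_comm]; exact this

theorem en_two_coord' (t : ℕ) (F : Finset V) (i j : Fin (t + 1)) (hij : j ≠ i) (τ : V → V) :
    #{p ∈ tup (t + 1) F ×ˢ tup (t + 1) F | ∑ l, p.1 l = ∑ l, p.2 l ∧ p.2 j = τ (p.2 i)}
      ≤ #F * en t F := by
  refine le_trans ?_ (en_two_coord t F i j hij τ)
  apply Finset.card_le_card_of_injOn Prod.swap
  · intro p hp
    simp only [coe_filter, mem_product, Set.mem_ofPred_eq] at hp ⊢
    exact ⟨⟨hp.1.2, hp.1.1⟩, hp.2.1.symm, hp.2.2⟩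
  · exact Prod.swap_injective.injOn

theorem en_succ_le (t : ℕ) (F : Finset V) : en (t + 1) F ≤ #F ^ 2 * en t F := by
  have key : ∀ a ∈ F ×ˢ F, #{p ∈ {p ∈ tup (t + 1) F ×ˢ tup (t + 1) F |
      ∑ l, p.1 l = ∑ l, p.2 l} | (p.1 0, p.2 0) = a} ≤ en t F := by
    rintro ⟨a, b⟩ hab
    have h1 : #{p ∈ {p ∈ tup (t + 1) F ×ˢ tup (t + 1) F |
      ∑ l, p.1 l = ∑ l, p.2 l} | (p.1 0, p.2 0) = (a, b)} ≤
      prs (tup t F) (tup t F) (fun Y => ∑ i, Y i + a) (fun Y => ∑ i, Y i + b) := by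
      unfold prs
      apply Finset.card_le_card_of_injOn (fun p : (Fin (t + 1) → V) × (Fin (t + 1) → V) => (rmv 0 p.1, rmv 0 p.2))
      · intro p hp
        simp only [coe_filter, mem_filter, mem_product, Set.mem_ofPred_eq, mem_tup,
          Prod.mk.injEq] at hp
        obtain ⟨⟨⟨h1, h2⟩, h3⟩, h4, h5⟩ := hp
        simp only [coe_filter, mem_product, Set.mem_ofPred_eq, mem_tup, rmv, Fin.zero_succAbove]
        refine ⟨⟨fun l => h1 _, fun l => h2 _⟩, ?_⟩
        rw [Fin.sum_univ_succ, Fin.sum_univ_succ, h4, h5] at h3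
        rw [add_comm, h3, add_comm]
      · intro p hp q hq h
        simp only [coe_filter, mem_filter, mem_product, Set.mem_ofPred_eq, mem_tup,
          Prod.mk.injEq] at hp hq h
        apply Prod.ext
        · exact rmv_ext 0 h.1 (by rw [hp.2.1, hq.2.1])
        · exact rmv_ext 0 h.2 (by rw [hp.2.2, hq.2.2])
    have h2 := prs_cs (tup t F) (tup t F) (fun Y => ∑ i, Y i + a) (fun Y => ∑ i, Y i + b)
    rw [en_shift, en_shift, ← sq] at h2
    exact h1.trans ((Nat.pow_le_pow_iff_left two_ne_zero).1 h2)
  have := Finset.card_le_mul_card_image_of_maps_to (s := {p ∈ tup (t + 1) F ×ˢ tup (t + 1) F |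
      ∑ l, p.1 l = ∑ l, p.2 l}) (t := F ×ˢ F) (f := fun p => (p.1 0, p.2 0))
    (by intro p hp
        simp only [mem_filter, mem_product, mem_tup] at hp
        exact mem_product.2 ⟨hp.1.1 0, hp.1.2 0⟩) (en t F) key
  rw [card_product, ← sq, mul_comm] at this
  exact this

theorem en_le (t : ℕ) (F : Finset V) : en (t + 1) F ≤ #F ^ (2 * t + 1) := by
  have : #F ^ (2 * t + 1) = #(tup (t + 1) F ×ˢ tup t F) := by
    rw [card_product, card_tup, card_tup]; ring
  rw [this]
  unfold en prs
  apply Finset.card_le_card_of_injOn (fun p : (Fin (t + 1) → V) × (Fin (t + 1) → V) => (p.1, rmv 0 p.2))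
  · intro p hp
    simp only [coe_filter, mem_product, Set.mem_ofPred_eq, mem_tup] at hp
    simp only [coe_product, Set.mem_prod, mem_coe, mem_tup, rmv, Fin.zero_succAbove]
    exact ⟨hp.1.1, fun l => hp.1.2 _⟩
  · intro p hp q hq h
    simp only [coe_filter, mem_product, Set.mem_ofPred_eq, mem_tup, Prod.mk.injEq] at hp hq h
    have h3 := hp.2
    have h4 := hq.2
    have e : ∀ l : Fin t, p.2 l.succ = q.2 l.succ := fun l => congrFun h.2 l
    rw [Fin.sum_univ_succ (f := p.2)] at h3
    rw [Fin.sum_univ_succ (f := q.2), ← h.1, h3] at h4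
    simp only [e, add_left_inj] at h4
    apply Prod.ext h.1
    exact rmv_ext 0 h.2 h4

theorem en_pos (t : ℕ) (F : Finset V) (hF : F.Nonempty) : 1 ≤ en t F := by
  obtain ⟨a, ha⟩ := hF
  unfold en prs
  apply Finset.card_pos.2
  exact ⟨(fun _ => a, fun _ => a), by simp [mem_tup, ha]⟩
end energy

section prime
variable {K : Type*} [Field K]

/-- bilinear form -/
def dt {R : Type*} [CommRing R] (x y : Fin 3 → R) : R := x 0 * y 0 + x 1 * y 1 + x 2 * y 2

theorem exists_ne_three {w : Fin 3 → K} (hw : w ≠ 0) : w 0 ≠ 0 ∨ w 1 ≠ 0 ∨ w 2 ≠ 0 := by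
  by_contra h
  push Not at h
  apply hw
  funext i
  fin_cases i
  · exact h.1
  · exact h.2.1
  · exact h.2.2

theorem iso_key {m : K} {w x v : Fin 3 → K} (hw : w ≠ 0) (hww : dt w w = 0)
    (hwx : dt w x = 0) (hwv : dt w v = 0) (hx : dt x x = m) (hv : dt v v + 2 * dt x v = 0) :
    dt v v = 0 ∨ dt v v = 4 * m := by
  simp only [dt] at *
  set c0 := x 1 * v 2 - x 2 * v 1 with hc0
  set c1 := x 2 * v 0 - x 0 * v 2 with hc1
  set c2 := x 0 * v 1 - x 1 * v 0 with hc2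
  have e01 : w 0 * c1 = w 1 * c0 := by
    rw [hc0, hc1]; linear_combination x 2 * hwv - v 2 * hwx
  have e12 : w 1 * c2 = w 2 * c1 := by
    rw [hc1, hc2]; linear_combination x 0 * hwv - v 0 * hwx
  have e20 : w 2 * c0 = w 0 * c2 := by
    rw [hc0, hc2]; linear_combination x 1 * hwv - v 1 * hwx
  have hcc : c0 ^ 2 + c1 ^ 2 + c2 ^ 2 = 0 := by
    rcases exists_ne_three hw with h | h | h
    · have : w 0 ^ 2 * (c0 ^ 2 + c1 ^ 2 + c2 ^ 2) = 0 := by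
        linear_combination c0 ^ 2 * hww + (w 0 * c1 + w 1 * c0) * e01 - (w 2 * c0 + w 0 * c2) * e20
      exact (mul_eq_zero.1 this).resolve_left (pow_ne_zero 2 h)
    · have : w 1 ^ 2 * (c0 ^ 2 + c1 ^ 2 + c2 ^ 2) = 0 := by
        linear_combination c1 ^ 2 * hww - (w 0 * c1 + w 1 * c0) * e01 + (w 1 * c2 + w 2 * c1) * e12
      exact (mul_eq_zero.1 this).resolve_left (pow_ne_zero 2 h)
    · have : w 2 ^ 2 * (c0 ^ 2 + c1 ^ 2 + c2 ^ 2) = 0 := by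
        linear_combination c2 ^ 2 * hww + (w 2 * c0 + w 0 * c2) * e20 - (w 1 * c2 + w 2 * c1) * e12
      exact (mul_eq_zero.1 this).resolve_left (pow_ne_zero 2 h)
  have hl : 4 * m * (v 0 * v 0 + v 1 * v 1 + v 2 * v 2) =
      (2 * (x 0 * v 0 + x 1 * v 1 + x 2 * v 2)) ^ 2 := by
    rw [← hx]
    rw [hc0, hc1, hc2] at hcc
    linear_combination 4 * hcc
  have hv' : 2 * (x 0 * v 0 + x 1 * v 1 + x 2 * v 2) = -(v 0 * v 0 + v 1 * v 1 + v 2 * v 2) := by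
    linear_combination hv
  rw [hv'] at hl
  set q := v 0 * v 0 + v 1 * v 1 + v 2 * v 2
  have : q * (q - 4 * m) = 0 := by linear_combination -hl
  rcases mul_eq_zero.1 this with h | h
  · left; exact h
  · right; linear_combination h

theorem par_key (h2 : (2 : K) ≠ 0) {m : K} {x u1 u2 z : Fin 3 → K} (hx : dt x x = m)
    (hu1 : u1 ≠ 0) (hu2 : u2 ≠ 0)
    (p01 : u1 0 * u2 1 = u1 1 * u2 0) (p12 : u1 1 * u2 2 = u1 2 * u2 1)
    (p20 : u1 2 * u2 0 = u1 0 * u2 2)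
    (q1 : dt u1 u1 + 2 * dt x u1 = 0) (q2 : dt u2 u2 + 2 * dt x u2 = 0)
    (hz : dt z u1 = 0) (qz : dt z z + 2 * dt x z = 0)
    (g1 : dt (u1 - z) (u1 - z) ≠ 0) (g2 : dt (u1 - z) (u1 - z) ≠ 4 * m) : u1 = u2 := by
  obtain ⟨l, hl⟩ : ∃ l : K, ∀ i, u2 i = l * u1 i := by
    rcases exists_ne_three hu1 with h | h | h
    · refine ⟨u2 0 / u1 0, fun i => ?_⟩
      fin_cases i <;> simp <;> field_simp
      · linear_combination p01
      · linear_combination -p20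
    · refine ⟨u2 1 / u1 1, fun i => ?_⟩
      fin_cases i <;> simp <;> field_simp
      · linear_combination -p01
      · linear_combination p12
    · refine ⟨u2 2 / u1 2, fun i => ?_⟩
      fin_cases i <;> simp <;> field_simp
      · linear_combination p20
      · linear_combination -p12
  have hl0 : l ≠ 0 := by
    rintro rfl
    exact hu2 (funext fun i => by rw [hl i]; simp)
  have hd : l * ((l - 1) * dt u1 u1) = 0 := by
    have : dt u2 u2 + 2 * dt x u2 = l * (l * dt u1 u1 + 2 * dt x u1) := by
      simp only [dt, hl]; ring
    rw [this] at q2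
    linear_combination q2 - l * q1
  rcases mul_eq_zero.1 ((mul_eq_zero.1 hd).resolve_left hl0) with h | h
  · have : l = 1 := by linear_combination h
    funext i; rw [hl i, this, one_mul]
  · exfalso
    have hxu : dt x u1 = 0 := by
      rw [h, zero_add] at q1
      exact (mul_eq_zero.1 q1).resolve_left h2
    have := iso_key (m := m) (w := u1) (x := x) (v := z - u1) hu1 h
      (by rw [← hxu]; simp only [dt]; ring)
      (by have : dt u1 (z - u1) = dt z u1 - dt u1 u1 := by simp only [dt, Pi.sub_apply]; ring
          rw [this, h, hz, sub_zero]) hx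
      (by have : dt (z - u1) (z - u1) + 2 * dt x (z - u1) = (dt z z + 2 * dt x z) - 2 * dt z u1
            + dt u1 u1 - 2 * dt x u1 := by simp only [dt, Pi.sub_apply]; ring
          rw [this, qz, hz, h, hxu]; ring)
    have e : dt (z - u1) (z - u1) = dt (u1 - z) (u1 - z) := by simp only [dt, Pi.sub_apply]; ring
    rw [e] at this
    rcases this with h' | h'
    · exact g1 h'
    · exact g2 h'

/-- good pairs -/
def gd {R : Type*} [CommRing R] (x y : Fin 3 → R) : Prop :=
  dt (x - y) (x - y) ≠ 0 ∧ dt (x + y) (x + y) ≠ 0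

theorem gd_comm {R : Type*} [CommRing R] {x y : Fin 3 → R} (h : gd x y) : gd y x := by
  unfold gd at *
  have e1 : dt (y - x) (y - x) = dt (x - y) (x - y) := by simp only [dt, Pi.sub_apply]; ring
  rw [e1, add_comm y x]
  exact h

theorem two_common (h2 : (2 : K) ≠ 0) {m : K} {x' x1 x2 y1 y2 : Fin 3 → K}
    (hx' : dt x' x' = m) (hx1 : dt x1 x1 = m) (hx2 : dt x2 x2 = m) (hy1 : dt y1 y1 = m)
    (hy2 : dt y2 y2 = m) (h12 : x1 ≠ x2) (n1 : x1 ≠ x') (n2 : x2 ≠ x') (k1 : y1 ≠ x') (k2 : y2 ≠ x')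
    (g11 : gd x1 y1)
    (s11 : dt (x1 + y1 - x') (x1 + y1 - x') = m) (s12 : dt (x1 + y2 - x') (x1 + y2 - x') = m)
    (s21 : dt (x2 + y1 - x') (x2 + y1 - x') = m) (s22 : dt (x2 + y2 - x') (x2 + y2 - x') = m) :
    y1 = y2 := by
  have hq : ∀ x : Fin 3 → K, dt x x = m → dt (x - x') (x - x') + 2 * dt x' (x - x') = 0 := by
    intro x hx
    have : dt (x - x') (x - x') + 2 * dt x' (x - x') = dt x x - dt x' x' := by
      simp only [dt, Pi.sub_apply]; ring
    rw [this, hx, hx', sub_self]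
  have hperp : ∀ x y : Fin 3 → K, dt x x = m → dt y y = m → dt (x + y - x') (x + y - x') = m →
      dt (x - x') (y - x') = 0 := by
    intro x y hx hy hs
    have : 2 * dt (x - x') (y - x') = dt (x + y - x') (x + y - x') + dt x' x' - dt x x - dt y y := by
      simp only [dt, Pi.sub_apply, Pi.add_apply]; ring
    rw [hs, hx, hy, hx'] at this
    have h3 : 2 * dt (x - x') (y - x') = 0 := by rw [this]; ring
    exact (mul_eq_zero.1 h3).resolve_left h2
  have dsym : ∀ x y : Fin 3 → K, dt x y = dt y x := by
    intro x y; simp only [dt]; ring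
  have r11 := hperp x1 y1 hx1 hy1 s11
  have r12 := hperp x1 y2 hx1 hy2 s12
  have r21 := hperp x2 y1 hx2 hy1 s21
  have r22 := hperp x2 y2 hx2 hy2 s22
  have q1 := hq x1 hx1
  have q2 := hq x2 hx2
  have qq1 := hq y1 hy1
  have qq2 := hq y2 hy2
  have gg : dt ((x1 - x') - (y1 - x')) ((x1 - x') - (y1 - x')) ≠ 0 ∧
      dt ((x1 - x') - (y1 - x')) ((x1 - x') - (y1 - x')) ≠ 4 * m := by
    have e : (x1 - x') - (y1 - x') = x1 - y1 := by abel
    rw [e]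
    refine ⟨g11.1, fun h => g11.2 ?_⟩
    have : dt (x1 + y1) (x1 + y1) = 2 * dt x1 x1 + 2 * dt y1 y1 - dt (x1 - y1) (x1 - y1) := by
      simp only [dt, Pi.sub_apply, Pi.add_apply]; ring
    rw [this, h, hx1, hy1]; ring
  have gg' : dt ((y1 - x') - (x1 - x')) ((y1 - x') - (x1 - x')) =
    dt ((x1 - x') - (y1 - x')) ((x1 - x') - (y1 - x')) := by
    simp only [dt, Pi.sub_apply]; ring
  have u1 : x1 - x' ≠ 0 := sub_ne_zero.2 n1
  have u2 : x2 - x' ≠ 0 := sub_ne_zero.2 n2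
  have z1 : y1 - x' ≠ 0 := sub_ne_zero.2 k1
  have z2 : y2 - x' ≠ 0 := sub_ne_zero.2 k2
  have u12 : x1 - x' ≠ x2 - x' := fun h => h12 (sub_left_injective h)
  suffices y1 - x' = y2 - x' from sub_left_injective this
  generalize x1 - x' = a at *
  generalize x2 - x' = b at *
  generalize y1 - x' = c at *
  generalize y2 - x' = d at *
  set w : Fin 3 → K := ![a 1 * b 2 - a 2 * b 1, a 2 * b 0 - a 0 * b 2, a 0 * b 1 - a 1 * b 0] with hw
  have w0 : w 0 = a 1 * b 2 - a 2 * b 1 := rfl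
  have w1 : w 1 = a 2 * b 0 - a 0 * b 2 := rfl
  have w2 : w 2 = a 0 * b 1 - a 1 * b 0 := rfl
  have hw0 : w ≠ 0 := by
    intro h0
    apply u12
    have i0 : w 0 = 0 := by rw [h0]; rfl
    have i1 : w 1 = 0 := by rw [h0]; rfl
    have i2 : w 2 = 0 := by rw [h0]; rfl
    rw [w0] at i0
    rw [w1] at i1
    rw [w2] at i2
    exact par_key h2 (z := c) hx' u1 u2 (by linear_combination i2) (by linear_combination i0)
      (by linear_combination i1) q1 q2 (by rw [dsym]; exact r11) qq1 gg.1 gg.2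
  have hpar : ∀ c : Fin 3 → K, dt a c = 0 → dt b c = 0 →
      w 0 * c 1 = w 1 * c 0 ∧ w 1 * c 2 = w 2 * c 1 ∧ w 2 * c 0 = w 0 * c 2 := by
    intro c ha hb
    rw [w0, w1, w2]
    simp only [dt] at ha hb
    refine ⟨?_, ?_, ?_⟩
    · linear_combination a 2 * hb * (-1) + b 2 * ha
    · linear_combination a 0 * hb * (-1) + b 0 * ha
    · linear_combination a 1 * hb * (-1) + b 1 * ha
  obtain ⟨c1, c2, c3⟩ := hpar c r11 r21
  obtain ⟨d1, d2, d3⟩ := hpar d r12 r22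
  have hcd : c 0 * d 1 = c 1 * d 0 ∧ c 1 * d 2 = c 2 * d 1 ∧ c 2 * d 0 = c 0 * d 2 := by
    have fin : ∀ i : Fin 3, w i ≠ 0 → ∀ j k : Fin 3, w i * c j = w j * c i → w i * c k = w k * c i →
        w i * d j = w j * d i → w i * d k = w k * d i → c j * d k = c k * d j := by
      intro i hi j k e1 e2 e3 e4
      apply mul_left_cancel₀ (pow_ne_zero 2 hi)
      linear_combination w i * d k * e1 + w j * c i * e4 - w i * d j * e2 - w k * c i * e3
    rcases exists_ne_three hw0 with h | h | h
    · exact ⟨fin 0 h 0 1 rfl c1 rfl d1, fin 0 h 1 2 c1 c3.symm d1 d3.symm,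
        fin 0 h 2 0 c3.symm rfl d3.symm rfl⟩
    · exact ⟨fin 1 h 0 1 c1.symm rfl d1.symm rfl, fin 1 h 1 2 rfl c2 rfl d2,
        fin 1 h 2 0 c2 c1.symm d2 d1.symm⟩
    · exact ⟨fin 2 h 0 1 c3 c2.symm d3 d2.symm, fin 2 h 1 2 c2.symm rfl d2.symm rfl,
        fin 2 h 2 0 rfl c3 rfl d3⟩
  exact par_key h2 (z := a) hx' z1 z2 hcd.1 hcd.2.1 hcd.2.2 qq1 qq2 r11 q1
    (by rw [gg']; exact gg.1) (by rw [gg']; exact gg.2)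
end prime

section counting
variable {K : Type*} [Field K] [DecidableEq K]

open Classical in
/-- good pairs in a product -/
def gpairs {R : Type*} [CommRing R] (B1 B2 : Finset (Fin 3 → R)) :
    Finset ((Fin 3 → R) × (Fin 3 → R)) := {q ∈ B1 ×ˢ B2 | gd q.1 q.2}

theorem mem_gpairs {R : Type*} [CommRing R] {B1 B2 : Finset (Fin 3 → R)}
    {q : (Fin 3 → R) × (Fin 3 → R)} :
    q ∈ gpairs B1 B2 ↔ q.1 ∈ B1 ∧ q.2 ∈ B2 ∧ gd q.1 q.2 := by
  simp [gpairs, and_assoc]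

theorem prime_fiber (h2 : (2 : K) ≠ 0) {m : K} (B1 B2 : Finset (Fin 3 → K))
    (hB1 : ∀ x ∈ B1, dt x x = m) (hB2 : ∀ x ∈ B2, dt x x = m) (x' : Fin 3 → K) (hx' : dt x' x' = m) :
    (#{q ∈ gpairs B1 B2 | dt (q.1 + q.2 - x') (q.1 + q.2 - x') = m} : ℝ) ≤
      2 * #B2 + 2 * #B1 * Real.sqrt #B2 := by
  set R := {q ∈ gpairs B1 B2 | dt (q.1 + q.2 - x') (q.1 + q.2 - x') = m} with hR
  set Z := {q ∈ R | ¬ q.1 = x'} with hZ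
  have hmR : ∀ q ∈ R, q.1 ∈ B1 ∧ q.2 ∈ B2 ∧ gd q.1 q.2 ∧
      dt (q.1 + q.2 - x') (q.1 + q.2 - x') = m := by
    intro q hq
    simp only [hR, mem_filter, mem_gpairs] at hq
    tauto
  have hmZ : ∀ q ∈ Z, q ∈ R ∧ q.1 ≠ x' := by
    intro q hq
    simpa only [hZ, mem_filter] using hq
  have hsplit : #R = #{q ∈ R | q.1 = x'} + #Z := by
    rw [hZ, Finset.card_filter_add_card_filter_not]
  have hb : #{q ∈ R | q.1 = x'} ≤ #B2 := by
    apply Finset.card_le_card_of_injOn Prod.snd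
    · intro q hq
      simp only [coe_filter, Set.mem_ofPred_eq] at hq
      exact (hmR q hq.1).2.1
    · intro q hq r hr h
      simp only [coe_filter, Set.mem_ofPred_eq] at hq hr
      exact Prod.ext (hq.2.trans hr.2.symm) h
  have hcs := prs_color Z (fun _ => (0 : ℕ)) (fun q => q.2) B2 (fun q hq => (hmR q (hmZ q hq).1).2.1)
  have hcs0 : prs Z Z (fun _ => (0 : ℕ)) (fun _ => (0 : ℕ)) = #Z * #Z := by
    simp [prs]
  rw [hcs0] at hcs
  have hW : #{p ∈ Z ×ˢ Z | (0 : ℕ) = 0 ∧ p.1.2 = p.2.2} ≤ #Z + 2 * (#B1 * #B1) := by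
    set W := {p ∈ Z ×ˢ Z | (0 : ℕ) = 0 ∧ p.1.2 = p.2.2} with hWd
    have hmW : ∀ p ∈ W, p.1 ∈ Z ∧ p.2 ∈ Z ∧ p.1.2 = p.2.2 := by
      intro p hp
      simp only [hWd, mem_filter, mem_product] at hp
      tauto
    rw [← Finset.card_filter_add_card_filter_not (s := W) (fun p => p.1.1 = p.2.1)]
    apply add_le_add
    · apply Finset.card_le_card_of_injOn Prod.fst
      · intro p hp
        simp only [coe_filter, Set.mem_ofPred_eq] at hp
        exact (hmW p hp.1).1
      · intro p hp r hr h
        simp only [coe_filter, Set.mem_ofPred_eq] at hp hr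
        have e1 := (hmW p hp.1).2.2
        have e2 := (hmW r hr.1).2.2
        have e3 : p.2 = p.1 := Prod.ext hp.2.symm e1.symm
        have e4 : r.2 = r.1 := Prod.ext hr.2.symm e2.symm
        exact Prod.ext h (by rw [e3, e4, h])
    · rw [← card_product]
      apply Finset.card_le_mul_card_image_of_maps_to (f := fun p => (p.1.1, p.2.1))
      · intro p hp
        simp only [mem_filter] at hp
        obtain ⟨h1, h2, _⟩ := hmW p hp.1
        exact mem_product.2 ⟨(hmR _ (hmZ _ h1).1).1, (hmR _ (hmZ _ h2).1).1⟩
      · rintro ⟨x1, x2⟩ _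
        set G := {p ∈ {p ∈ W | ¬ p.1.1 = p.2.1} | (p.1.1, p.2.1) = (x1, x2)} with hG
        have hmG : ∀ p ∈ G, p ∈ W ∧ p.1.1 ≠ p.2.1 ∧ p.1.1 = x1 ∧ p.2.1 = x2 := by
          intro p hp
          simp only [hG, mem_filter, Prod.mk.injEq] at hp
          tauto
        rw [← Finset.card_filter_add_card_filter_not (s := G) (fun p => p.1.2 = x')]
        have c1 : #{p ∈ G | p.1.2 = x'} ≤ 1 := by
          rw [Finset.card_le_one]
          intro p hp r hr
          simp only [mem_filter] at hp hr
          obtain ⟨a1, _, a3, a4⟩ := hmG p hp.1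
          obtain ⟨b1, _, b3, b4⟩ := hmG r hr.1
          have a5 := (hmW p a1).2.2
          have b5 := (hmW r b1).2.2
          apply Prod.ext
          · exact Prod.ext (a3.trans b3.symm) (hp.2.trans hr.2.symm)
          · exact Prod.ext (a4.trans b4.symm) (by rw [← a5, ← b5, hp.2, hr.2])
        have c2 : #{p ∈ G | ¬ p.1.2 = x'} ≤ 1 := by
          rw [Finset.card_le_one]
          intro p hp r hr
          simp only [mem_filter] at hp hr
          obtain ⟨a1, a2, a3, a4⟩ := hmG p hp.1
          obtain ⟨b1, b2, b3, b4⟩ := hmG r hr.1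
          obtain ⟨w1, w2, a5⟩ := hmW p a1
          obtain ⟨v1, v2, b5⟩ := hmW r b1
          obtain ⟨w1, w1'⟩ := hmZ _ w1
          obtain ⟨w2, w2'⟩ := hmZ _ w2
          obtain ⟨v1, v1'⟩ := hmZ _ v1
          obtain ⟨v2, v2'⟩ := hmZ _ v2
          obtain ⟨p1, p2, p3, p4⟩ := hmR _ w1
          obtain ⟨q1, q2, q3, q4⟩ := hmR _ w2
          obtain ⟨r1, r2, r3, r4⟩ := hmR _ v1
          obtain ⟨s1, s2, s3, s4⟩ := hmR _ v2
          have hy : p.1.2 = r.1.2 := by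
            apply two_common h2 (x' := x') (x1 := p.1.1) (x2 := p.2.1) (m := m) hx' (hB1 _ p1)
              (hB1 _ q1) (hB2 _ p2) (hB2 _ r2) a2 w1' w2' hp.2 hr.2 p3 p4
            · rw [a3, ← b3]; exact r4
            · rw [a5]; exact q4
            · rw [a4, ← b4, b5]; exact s4
          apply Prod.ext
          · exact Prod.ext (a3.trans b3.symm) hy
          · exact Prod.ext (a4.trans b4.symm) (by rw [← a5, ← b5, hy])
        omega
  have h3 : #Z * #Z ≤ #B2 * (#Z + 2 * (#B1 * #B1)) := hcs.trans (Nat.mul_le_mul_left _ hW)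
  have h3R : (#Z : ℝ) * #Z ≤ #B2 * (#Z + 2 * (#B1 * #B1)) := by exact_mod_cast h3
  have hs := Real.mul_self_sqrt (Nat.cast_nonneg (α := ℝ) #B2)
  have hs0 := Real.sqrt_nonneg (#B2 : ℝ)
  have hbR : (#{q ∈ R | q.1 = x'} : ℝ) ≤ #B2 := by exact_mod_cast hb
  have hI : (#Z : ℝ) ≤ #B2 + 2 * #B1 * Real.sqrt #B2 := by
    by_contra hcon
    push Not at hcon
    have p0 : (0 : ℝ) ≤ #B2 := by positivity
    have p1 : (0 : ℝ) ≤ #B1 * Real.sqrt #B2 := by positivity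
    have e : (#B1 * Real.sqrt #B2) * (#B1 * Real.sqrt #B2) = #B1 * #B1 * (#B2 : ℝ) := by
      rw [← hs]; simp only [hs]; linear_combination (#B1 : ℝ) * #B1 * hs
    have e2 : (#B2 + 2 * (#B1 * Real.sqrt #B2)) * (2 * (#B1 * Real.sqrt #B2)) ≤ #Z * ((#Z : ℝ) - #B2) := by
      apply mul_le_mul <;> nlinarith
    have e3 : (#Z : ℝ) > 0 := by nlinarith
    have e4 : 0 < (#B1 * Real.sqrt #B2) ∨ (#B1 * Real.sqrt #B2) = 0 := by
      rcases p1.lt_or_eq with h | h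
      · left; exact h
      · right; exact h.symm
    rcases e4 with h | h
    · nlinarith
    · rw [h] at e
      nlinarith
  rw [hsplit]
  push_cast
  linarith

theorem prime_count_one (h2 : (2 : K) ≠ 0) {m : K} (B1 B2 : Finset (Fin 3 → K))
    (hB1 : ∀ x ∈ B1, dt x x = m) (hB2 : ∀ x ∈ B2, dt x x = m) :
    (prs (gpairs B1 B2) (gpairs B1 B2) (fun q => q.1 + q.2) (fun q => q.1 + q.2) : ℝ) ≤
      #B1 * (2 * #B2 + 2 * #B1 * Real.sqrt #B2) := by
  unfold prs
  rw [Finset.card_eq_sum_card_fiberwise (f := fun p => p.2.1) (t := B1)]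
  · push_cast
    rw [← nsmul_eq_mul]
    apply Finset.sum_le_card_nsmul
    intro x' hx'
    refine le_trans ?_ (prime_fiber h2 B1 B2 hB1 hB2 x' (hB1 _ hx'))
    norm_cast
    apply Finset.card_le_card_of_injOn Prod.fst
    · intro p hp
      simp only [coe_filter, mem_filter, mem_product, Set.mem_ofPred_eq, mem_gpairs] at hp ⊢
      obtain ⟨⟨⟨h1, h2⟩, h3⟩, h4⟩ := hp
      refine ⟨h1, ?_⟩
      rw [h3, ← h4, add_sub_cancel_left]
      exact hB2 _ h2.2.1
    · intro p hp r hr h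
      simp only [coe_filter, mem_filter, mem_product, Set.mem_ofPred_eq, mem_gpairs] at hp hr
      apply Prod.ext h
      have e1 : p.2.1 = r.2.1 := hp.2.trans hr.2.symm
      apply Prod.ext e1
      have a := hp.1.2
      have b := hr.1.2
      rw [h, e1] at a
      exact add_left_cancel (a.symm.trans b)
  · intro p hp
    simp only [coe_filter, mem_product, Set.mem_ofPred_eq, mem_gpairs] at hp
    exact hp.1.2.1

theorem gp_swap (B1 B2 : Finset (Fin 3 → K)) :
    prs (gpairs B1 B2) (gpairs B1 B2) (fun q => q.1 + q.2) (fun q => q.1 + q.2) ≤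
    prs (gpairs B2 B1) (gpairs B2 B1) (fun q => q.1 + q.2) (fun q => q.1 + q.2) := by
  unfold prs
  apply Finset.card_le_card_of_injOn (fun p => (p.1.swap, p.2.swap))
  · intro p hp
    simp only [coe_filter, mem_product, Set.mem_ofPred_eq, mem_gpairs, Prod.fst_swap,
      Prod.snd_swap] at hp ⊢
    obtain ⟨⟨⟨a, b, c⟩, d, e, f⟩, g⟩ := hp
    exact ⟨⟨⟨b, a, gd_comm c⟩, e, d, gd_comm f⟩, by rw [add_comm, g, add_comm]⟩
  · intro p _ r _ h
    simp only [Prod.mk.injEq] at h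
    exact Prod.ext (Prod.swap_injective h.1) (Prod.swap_injective h.2)

theorem prime_count (h2 : (2 : K) ≠ 0) {m : K} (B1 B2 : Finset (Fin 3 → K))
    (hB1 : ∀ x ∈ B1, dt x x = m) (hB2 : ∀ x ∈ B2, dt x x = m) :
    (prs (gpairs B1 B2) (gpairs B1 B2) (fun q => q.1 + q.2) (fun q => q.1 + q.2) : ℝ) ≤
      4 * ((#B1 : ℝ) * #B2) ^ (5 / 4 : ℝ) := by
  have num : ∀ a b : ℕ, a ≤ b → (a : ℝ) * (2 * b + 2 * a * Real.sqrt b) ≤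
      4 * ((a : ℝ) * b) ^ (5 / 4 : ℝ) := by
    intro a b hab
    have habR : (a : ℝ) ≤ b := by exact_mod_cast hab
    rcases Nat.eq_zero_or_pos a with rfl | ha
    · simp
    have ha1 : (1 : ℝ) ≤ a := by exact_mod_cast ha
    have hb1 : (1 : ℝ) ≤ b := ha1.trans habR
    have p4 : (((a : ℝ) * b) ^ (5 / 4 : ℝ)) ^ 4 = ((a : ℝ) * b) ^ 5 := by
      rw [← Real.rpow_natCast, ← Real.rpow_mul (by positivity), ← Real.rpow_natCast]
      norm_num
    have l1 : (a : ℝ) * b ≤ ((a : ℝ) * b) ^ (5 / 4 : ℝ) := by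
      have : (1 : ℝ) ≤ a * b := by nlinarith
      calc (a : ℝ) * b = ((a : ℝ) * b) ^ (1 : ℝ) := by simp
        _ ≤ _ := Real.rpow_le_rpow_of_exponent_le this (by norm_num)
    have l2 : (a : ℝ) * a * Real.sqrt b ≤ ((a : ℝ) * b) ^ (5 / 4 : ℝ) := by
      apply le_of_pow_le_pow_left₀ (n := 4) (by norm_num) (by positivity)
      rw [p4]
      have : ((a : ℝ) * a * Real.sqrt b) ^ 4 = a ^ 5 * a ^ 3 * (Real.sqrt b ^ 2) ^ 2 := by ring
      rw [this, Real.sq_sqrt (by positivity)]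
      calc (a : ℝ) ^ 5 * a ^ 3 * b ^ 2 ≤ (a : ℝ) ^ 5 * b ^ 3 * b ^ 2 := by gcongr
        _ = _ := by ring
    nlinarith
  rcases le_total #B1 #B2 with h | h
  · exact (prime_count_one h2 B1 B2 hB1 hB2).trans (num _ _ h)
  · rw [mul_comm (#B1 : ℝ)]
    refine le_trans ?_ ((prime_count_one h2 B2 B1 hB2 hB1).trans (num _ _ h))
    exact_mod_cast gp_swap B1 B2
end counting

theorem wsum_eq {ι γ : Type*} [DecidableEq γ] (S : Finset ι) (f : ι → γ) (w : ι → ℝ) (T : Finset γ)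
    (hT : ∀ q ∈ S, f q ∈ T) :
    ∑ q ∈ S, ∑ q' ∈ S, (if f q = f q' then w q * w q' else 0) =
      ∑ v ∈ T, (∑ q ∈ S with f q = v, w q) ^ 2 := by
  simp_rw [sq, Finset.sum_filter, Finset.sum_mul_sum]
  rw [Finset.sum_comm]
  rw [Finset.sum_comm (s := T)]
  rw [Finset.sum_comm]
  apply Finset.sum_congr rfl
  intro q hq
  rw [Finset.sum_comm (s := T)]
  apply Finset.sum_congr rfl
  intro q' _
  rw [Finset.sum_eq_single (f q)]
  · by_cases h : f q = f q' <;> simp [h, eq_comm]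
  · intro v _ hv
    simp [hv.symm]
  · intro h; exact absurd (hT q hq) h

theorem wcolor {ι γ κ : Type*} [DecidableEq γ] [DecidableEq κ] (S : Finset ι) (f : ι → γ)
    (w : ι → ℝ) (c : ι → κ) (T : Finset κ) (hT : ∀ q ∈ S, c q ∈ T) :
    ∑ q ∈ S, ∑ q' ∈ S, (if f q = f q' then w q * w q' else 0) ≤
      #T * ∑ k ∈ T, ∑ q ∈ S with c q = k, ∑ q' ∈ S with c q' = k,
        (if f q = f q' then w q * w q' else 0) := by
  have h1 : ∀ q ∈ S, f q ∈ S.image f := fun q hq => mem_image_of_mem _ hq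
  rw [wsum_eq S f w _ h1]
  have h2 : ∀ k ∈ T, ∑ q ∈ S with c q = k, ∑ q' ∈ S with c q' = k,
        (if f q = f q' then w q * w q' else 0) =
        ∑ v ∈ S.image f, (∑ q ∈ {q ∈ S | c q = k} with f q = v, w q) ^ 2 := by
    intro k _
    apply wsum_eq
    intro q hq
    exact h1 q (mem_filter.1 hq).1
  rw [Finset.sum_congr rfl h2, Finset.sum_comm, Finset.mul_sum]
  apply Finset.sum_le_sum
  intro v _
  have h3 : ∑ q ∈ S with f q = v, w q = ∑ k ∈ T, ∑ q ∈ {q ∈ S | c q = k} with f q = v, w q := by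
    rw [← Finset.sum_fiberwise_of_maps_to (s := {q ∈ S | f q = v}) (t := T) (g := c)]
    · apply Finset.sum_congr rfl
      intro k _
      rw [filter_filter, filter_filter]
      simp_rw [and_comm]
    · intro q hq
      exact hT q (mem_filter.1 hq).1
  rw [h3]
  exact sq_sum_le_card_mul_sum_sq

section counting
variable {K : Type*} [Field K] [DecidableEq K]

theorem prime_weighted (h2 : (2 : K) ≠ 0) {m : K} (B1 B2 : Finset (Fin 3 → K))
    (hB1 : ∀ x ∈ B1, dt x x = m) (hB2 : ∀ x ∈ B2, dt x x = m) (l : ℕ)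
    (α β : (Fin 3 → K) → ℕ) (hα : ∀ x ∈ B1, 0 < α x ∧ α x < 2 ^ l)
    (hβ : ∀ x ∈ B2, 0 < β x ∧ β x < 2 ^ l) :
    ∑ q ∈ gpairs B1 B2, ∑ q' ∈ gpairs B1 B2, (if q.1 + q.2 = q'.1 + q'.2 then
      ((α q.1 : ℝ) * β q.2) ^ (5 / 8 : ℝ) * ((α q'.1 : ℝ) * β q'.2) ^ (5 / 8 : ℝ) else 0) ≤
      (32 * (l : ℝ) ^ 4) * ((∑ x ∈ B1, (α x : ℝ)) * ∑ x ∈ B2, (β x : ℝ)) ^ (5 / 4 : ℝ) := by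
  set P := ((∑ x ∈ B1, (α x : ℝ)) * ∑ x ∈ B2, (β x : ℝ)) with hP
  have h := wcolor (gpairs B1 B2) (fun q => q.1 + q.2)
    (fun q => ((α q.1 : ℝ) * β q.2) ^ (5 / 8 : ℝ))
    (fun q => (Nat.log 2 (α q.1), Nat.log 2 (β q.2))) (range l ×ˢ range l) (by
      intro q hq
      rw [mem_gpairs] at hq
      have a := hα _ hq.1
      have b := hβ _ hq.2.1
      rw [mem_product, mem_range, mem_range]
      exact ⟨Nat.log_lt_of_lt_pow a.1.ne' a.2, Nat.log_lt_of_lt_pow b.1.ne' b.2⟩)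
  refine h.trans ?_
  have key : ∀ k ∈ range l ×ˢ range l,
      (∑ q ∈ gpairs B1 B2 with (Nat.log 2 (α q.1), Nat.log 2 (β q.2)) = k,
      ∑ q' ∈ gpairs B1 B2 with (Nat.log 2 (α q'.1), Nat.log 2 (β q'.2)) = k,
        (if q.1 + q.2 = q'.1 + q'.2 then ((α q.1 : ℝ) * β q.2) ^ (5 / 8 : ℝ) *
          ((α q'.1 : ℝ) * β q'.2) ^ (5 / 8 : ℝ) else 0)) ≤ 32 * P ^ (5 / 4 : ℝ) := by
    rintro ⟨i, j⟩ _
    set C1 := {x ∈ B1 | Nat.log 2 (α x) = i} with hC1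
    set C2 := {x ∈ B2 | Nat.log 2 (β x) = j} with hC2
    have hset : {q ∈ gpairs B1 B2 | (Nat.log 2 (α q.1), Nat.log 2 (β q.2)) = (i, j)} =
        gpairs C1 C2 := by
      ext q
      simp only [mem_filter, mem_gpairs, hC1, hC2, Prod.mk.injEq]
      tauto
    rw [hset]
    have hw : ∀ q ∈ gpairs C1 C2, ((α q.1 : ℝ) * β q.2) ^ (5 / 8 : ℝ) ≤
        ((2 : ℝ) ^ (i + 1) * 2 ^ (j + 1)) ^ (5 / 8 : ℝ) := by
      intro q hq
      rw [mem_gpairs] at hq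
      simp only [hC1, hC2, mem_filter] at hq
      have a : α q.1 < 2 ^ (i + 1) := by
        rw [← hq.1.2]; exact Nat.lt_pow_succ_log_self (by norm_num) _
      have b : β q.2 < 2 ^ (j + 1) := by
        rw [← hq.2.1.2]; exact Nat.lt_pow_succ_log_self (by norm_num) _
      have aR : (α q.1 : ℝ) ≤ 2 ^ (i + 1) := by exact_mod_cast a.le
      have bR : (β q.2 : ℝ) ≤ 2 ^ (j + 1) := by exact_mod_cast b.le
      gcongr
    have hc := prime_count h2 C1 C2 (fun x hx => hB1 x (mem_filter.1 hx).1)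
      (fun x hx => hB2 x (mem_filter.1 hx).1)
    have s1 : (2 : ℝ) ^ i * #C1 ≤ ∑ x ∈ B1, (α x : ℝ) := by
      calc (2 : ℝ) ^ i * #C1 = ∑ x ∈ C1, (2 : ℝ) ^ i := by simp [mul_comm]
        _ ≤ ∑ x ∈ C1, (α x : ℝ) := by
          apply Finset.sum_le_sum
          intro x hx
          simp only [hC1, mem_filter] at hx
          have := Nat.pow_log_le_self 2 (hα x hx.1).1.ne'
          rw [hx.2] at this
          exact_mod_cast this
        _ ≤ _ := Finset.sum_le_sum_of_subset_of_nonneg (filter_subset _ _)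
          (fun _ _ _ => by positivity)
    have s2 : (2 : ℝ) ^ j * #C2 ≤ ∑ x ∈ B2, (β x : ℝ) := by
      calc (2 : ℝ) ^ j * #C2 = ∑ x ∈ C2, (2 : ℝ) ^ j := by simp [mul_comm]
        _ ≤ ∑ x ∈ C2, (β x : ℝ) := by
          apply Finset.sum_le_sum
          intro x hx
          simp only [hC2, mem_filter] at hx
          have := Nat.pow_log_le_self 2 (hβ x hx.1).1.ne'
          rw [hx.2] at this
          exact_mod_cast this
        _ ≤ _ := Finset.sum_le_sum_of_subset_of_nonneg (filter_subset _ _)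
          (fun _ _ _ => by positivity)
    set M := ((2 : ℝ) ^ (i + 1) * 2 ^ (j + 1)) with hM
    have hM0 : 0 < M := by positivity
    have hMM : M ^ (5 / 8 : ℝ) * M ^ (5 / 8 : ℝ) = M ^ (5 / 4 : ℝ) := by
      rw [← Real.rpow_add hM0]; norm_num
    calc (∑ q ∈ gpairs C1 C2, ∑ q' ∈ gpairs C1 C2,
        (if q.1 + q.2 = q'.1 + q'.2 then ((α q.1 : ℝ) * β q.2) ^ (5 / 8 : ℝ) *
          ((α q'.1 : ℝ) * β q'.2) ^ (5 / 8 : ℝ) else 0))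
        ≤ ∑ q ∈ gpairs C1 C2, ∑ q' ∈ gpairs C1 C2,
        (if q.1 + q.2 = q'.1 + q'.2 then M ^ (5 / 4 : ℝ) else 0) := by
          apply Finset.sum_le_sum
          intro q hq
          apply Finset.sum_le_sum
          intro q' hq'
          split_ifs
          · rw [← hMM]
            exact mul_le_mul (hw q hq) (hw q' hq') (by positivity) (by positivity)
          · exact le_rfl
      _ = M ^ (5 / 4 : ℝ) * prs (gpairs C1 C2) (gpairs C1 C2) (fun q => q.1 + q.2)
          (fun q => q.1 + q.2) := by
          rw [← Finset.sum_product', ← Finset.sum_filter]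
          simp [prs, mul_comm]
      _ ≤ M ^ (5 / 4 : ℝ) * (4 * ((#C1 : ℝ) * #C2) ^ (5 / 4 : ℝ)) := by gcongr
      _ = 4 * (4 * ((2 ^ i * #C1) * (2 ^ j * #C2))) ^ (5 / 4 : ℝ) := by
          rw [mul_left_comm, ← Real.mul_rpow (by positivity) (by positivity)]
          congr 2
          rw [hM]; ring
      _ ≤ 4 * (4 * P) ^ (5 / 4 : ℝ) := by
          rw [hP]; gcongr
      _ = 4 * 4 ^ (5 / 4 : ℝ) * P ^ (5 / 4 : ℝ) := by
          have : 0 ≤ P := by positivity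
          rw [Real.mul_rpow (by norm_num) this]; ring
      _ ≤ 32 * P ^ (5 / 4 : ℝ) := by
          have h4 : (4 : ℝ) ^ (5 / 4 : ℝ) ≤ 8 := by
            calc (4 : ℝ) ^ (5 / 4 : ℝ) ≤ 4 ^ (3 / 2 : ℝ) :=
                  Real.rpow_le_rpow_of_exponent_le (by norm_num) (by norm_num)
              _ = 8 := by
                rw [show (4 : ℝ) = 2 ^ (2 : ℝ) by norm_num, ← Real.rpow_mul (by norm_num)]
                norm_num
          have : 0 ≤ P := by positivity
          have : 0 ≤ P ^ (5 / 4 : ℝ) := by positivity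
          nlinarith
  have := Finset.sum_le_card_nsmul _ _ _ key
  calc _ ≤ (#(range l ×ˢ range l) : ℝ) * (#(range l ×ˢ range l) • (32 * P ^ (5 / 4 : ℝ))) := by
        gcongr
    _ = _ := by
      rw [card_product, card_range, nsmul_eq_mul]; push_cast; ring
end counting

/-- reduction modulo `q` -/
def red (q : ℕ) (a : Fin 3 → ℤ) : Fin 3 → ZMod q := fun c => (a c : ZMod q)

theorem red_add (q : ℕ) (a b : Fin 3 → ℤ) : red q (a + b) = red q a + red q b := by
  funext c; simp [red]

theorem red_dt (q : ℕ) (a : Fin 3 → ℤ) : dt (red q a) (red q a) = ((dt a a : ℤ) : ZMod q) := by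
  simp [red, dt]

/-- the first `j` residues -/
def resid (p : ℕ → ℕ) (j : ℕ) (a : Fin 3 → ℤ) : (i : ℕ) → Fin 3 → ZMod (p i) :=
  fun i => if i < j then red (p i) a else 0

theorem resid_add (p : ℕ → ℕ) (j : ℕ) (a b : Fin 3 → ℤ) :
    resid p j (a + b) = resid p j a + resid p j b := by
  funext i
  simp only [resid, Pi.add_apply]
  split_ifs
  · rw [red_add]
  · simp

theorem resid_eq_iff (p : ℕ → ℕ) (j : ℕ) (a b : Fin 3 → ℤ) :
    resid p j a = resid p j b ↔ ∀ i < j, red (p i) a = red (p i) b := by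
  constructor
  · intro h i hi
    have := congrFun h i
    simpa [resid, hi] using this
  · intro h
    funext i
    simp only [resid]
    split_ifs with hi
    · exact h i hi
    · rfl

theorem resid_succ_iff (p : ℕ → ℕ) (j : ℕ) (a b : Fin 3 → ℤ) :
    resid p (j + 1) a = resid p (j + 1) b ↔ resid p j a = resid p j b ∧ red (p j) a = red (p j) b := by
  rw [resid_eq_iff, resid_eq_iff]
  constructor
  · intro h
    exact ⟨fun i hi => h i (by omega), h j (by omega)⟩
  · rintro ⟨h1, h2⟩ i hi
    rcases Nat.lt_succ_iff_lt_or_eq.1 hi with h | rfl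
    · exact h1 i h
    · exact h2

/-- good at the first `j` primes -/
def gdj (p : ℕ → ℕ) (j : ℕ) (a b : Fin 3 → ℤ) : Prop := ∀ i < j, gd (red (p i) a) (red (p i) b)

open Classical in
/-- pairs good at the first `j` primes -/
def Gj (p : ℕ → ℕ) (j : ℕ) (A A' : Finset (Fin 3 → ℤ)) : Finset ((Fin 3 → ℤ) × (Fin 3 → ℤ)) :=
  {q ∈ A ×ˢ A' | gdj p j q.1 q.2}

theorem mem_Gj {p : ℕ → ℕ} {j : ℕ} {A A' : Finset (Fin 3 → ℤ)} {q : (Fin 3 → ℤ) × (Fin 3 → ℤ)} :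
    q ∈ Gj p j A A' ↔ q.1 ∈ A ∧ q.2 ∈ A' ∧ gdj p j q.1 q.2 := by
  simp [Gj, and_assoc]

open Classical in
/-- the count of good quadruples -/
def Tj (p : ℕ → ℕ) (j : ℕ) (A A' : Finset (Fin 3 → ℤ)) : ℕ :=
  prs (Gj p j A A') (Gj p j A A') (fun q => resid p j (q.1 + q.2)) (fun q => resid p j (q.1 + q.2))

open Classical in
theorem T_bound (p : ℕ → ℕ) (hp : ∀ i, (p i).Prime ∧ p i ≠ 2) (m : ℤ) (l : ℕ) (L : ℝ) (hL : 0 ≤ L)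
    (j : ℕ) : ∀ (A A' : Finset (Fin 3 → ℤ)), (∀ a ∈ A, dt a a = m) → (∀ a ∈ A', dt a a = m) →
    #A < 2 ^ l → #A' < 2 ^ l →
    (∀ a ∈ A, (#{b ∈ A | resid p j b = resid p j a} : ℝ) ≤ L) →
    (∀ a ∈ A', (#{b ∈ A' | resid p j b = resid p j a} : ℝ) ≤ L) →
    (Tj p j A A' : ℝ) ≤ (32 * (l : ℝ) ^ 4) ^ j * L ^ (3 / 2 : ℝ) *
      ((#A : ℝ) * #A') ^ (5 / 4 : ℝ) := by
  induction j with
  | zero =>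
    intro A A' _ _ _ _ hf hf'
    rcases A.eq_empty_or_nonempty with rfl | ⟨a, ha⟩
    · have : Tj p 0 ∅ A' = 0 := by simp [Tj, prs, Gj]
      rw [this, Nat.cast_zero]; positivity
    rcases A'.eq_empty_or_nonempty with rfl | ⟨a', ha'⟩
    · have : Tj p 0 A ∅ = 0 := by simp [Tj, prs, Gj]
      rw [this, Nat.cast_zero]; positivity
    have e1 := hf a ha
    have e2 := hf' a' ha'
    simp only [resid_eq_iff, not_lt_zero, false_implies, implies_true, filter_true] at e1 e2
    have h1 : Tj p 0 A A' ≤ (#A * #A') * (#A * #A') := by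
      unfold Tj prs
      refine (card_filter_le _ _).trans ?_
      rw [card_product]
      have : #(Gj p 0 A A') ≤ #A * #A' := by
        unfold Gj
        refine (card_filter_le _ _).trans ?_
        rw [card_product]
      exact Nat.mul_le_mul this this
    have hA : (1 : ℝ) ≤ #A := by exact_mod_cast card_pos.2 ⟨a, ha⟩
    have hA' : (1 : ℝ) ≤ #A' := by exact_mod_cast card_pos.2 ⟨a', ha'⟩
    calc (Tj p 0 A A' : ℝ) ≤ ((#A * #A') * (#A * #A') : ℕ) := by exact_mod_cast h1
      _ = ((#A : ℝ) * #A') ^ (2 : ℝ) := by push_cast; norm_num [sq]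
      _ = ((#A : ℝ) * #A') ^ (3 / 4 : ℝ) * ((#A : ℝ) * #A') ^ (5 / 4 : ℝ) := by
        rw [← Real.rpow_add (by positivity)]; norm_num
      _ ≤ (L ^ (2 : ℝ)) ^ (3 / 4 : ℝ) * ((#A : ℝ) * #A') ^ (5 / 4 : ℝ) := by
        have : (#A : ℝ) * #A' ≤ L ^ (2 : ℝ) := by
          norm_num [sq]; gcongr
        gcongr
      _ = _ := by
        rw [← Real.rpow_mul hL]; norm_num
  | succ j ih =>
    intro A A' hA hA' hAl hAl' hf hf'
    have : Fact (p j).Prime := ⟨(hp j).1⟩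
    have h2 : (2 : ZMod (p j)) ≠ 0 := by
      have : ((2 : ℕ) : ZMod (p j)) ≠ 0 := by
        intro h
        rw [ZMod.natCast_eq_zero_iff] at h
        exact (hp j).2 ((Nat.prime_dvd_prime_iff_eq (hp j).1 Nat.prime_two).1 h)
      simpa using this
    set B1 := A.image (red (p j)) with hB1
    set B2 := A'.image (red (p j)) with hB2
    set A1 : (Fin 3 → ZMod (p j)) → Finset (Fin 3 → ℤ) := fun b => {a ∈ A | red (p j) a = b} with hA1
    set A2 : (Fin 3 → ZMod (p j)) → Finset (Fin 3 → ℤ) := fun b => {a ∈ A' | red (p j) a = b} with hA2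
    set Kc : ℝ := (32 * (l : ℝ) ^ 4) ^ j * L ^ (3 / 2 : ℝ) with hKc
    have hKc0 : 0 ≤ Kc := by positivity
    have hS1 : ∀ b ∈ B1, dt b b = ((m : ℤ) : ZMod (p j)) := by
      intro b hb
      obtain ⟨a, ha, rfl⟩ := mem_image.1 hb
      rw [red_dt, hA a ha]
    have hS2 : ∀ b ∈ B2, dt b b = ((m : ℤ) : ZMod (p j)) := by
      intro b hb
      obtain ⟨a, ha, rfl⟩ := mem_image.1 hb
      rw [red_dt, hA' a ha]
    have hpos1 : ∀ b ∈ B1, 0 < #(A1 b) ∧ #(A1 b) < 2 ^ l := by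
      intro b hb
      obtain ⟨a, ha, rfl⟩ := mem_image.1 hb
      exact ⟨card_pos.2 ⟨a, by simp [hA1, ha]⟩, (card_filter_le _ _).trans_lt hAl⟩
    have hpos2 : ∀ b ∈ B2, 0 < #(A2 b) ∧ #(A2 b) < 2 ^ l := by
      intro b hb
      obtain ⟨a, ha, rfl⟩ := mem_image.1 hb
      exact ⟨card_pos.2 ⟨a, by simp [hA2, ha]⟩, (card_filter_le _ _).trans_lt hAl'⟩
    have hw := prime_weighted h2 B1 B2 hS1 hS2 l (fun b => #(A1 b)) (fun b => #(A2 b)) hpos1 hpos2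
    have hc1 : ∑ b ∈ B1, (#(A1 b) : ℝ) = #A := by
      rw [Finset.card_eq_sum_card_image (red (p j)) A]; push_cast; rfl
    have hc2 : ∑ b ∈ B2, (#(A2 b) : ℝ) = #A' := by
      rw [Finset.card_eq_sum_card_image (red (p j)) A']; push_cast; rfl
    simp only [hc1, hc2] at hw
    have hIH : ∀ q : (Fin 3 → ZMod (p j)) × (Fin 3 → ZMod (p j)),
        Real.sqrt (Tj p j (A1 q.1) (A2 q.2)) ≤
        Real.sqrt Kc * ((#(A1 q.1) : ℝ) * #(A2 q.2)) ^ (5 / 8 : ℝ) := by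
      intro q
      have := ih (A1 q.1) (A2 q.2) (fun a ha => hA a (mem_filter.1 ha).1)
        (fun a ha => hA' a (mem_filter.1 ha).1) ((card_filter_le _ _).trans_lt hAl)
        ((card_filter_le _ _).trans_lt hAl') (by
          intro a ha
          have ha' := mem_filter.1 ha
          refine le_trans ?_ (hf a ha'.1)
          norm_cast
          apply card_le_card
          intro b hb
          simp only [hA1, mem_filter] at hb ⊢
          exact ⟨hb.1.1, (resid_succ_iff _ _ _ _).2 ⟨hb.2, by rw [hb.1.2, ha'.2]⟩⟩) (by
          intro a ha
          have ha' := mem_filter.1 ha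
          refine le_trans ?_ (hf' a ha'.1)
          norm_cast
          apply card_le_card
          intro b hb
          simp only [hA2, mem_filter] at hb ⊢
          exact ⟨hb.1.1, (resid_succ_iff _ _ _ _).2 ⟨hb.2, by rw [hb.1.2, ha'.2]⟩⟩)
      refine (Real.sqrt_le_sqrt this).trans (le_of_eq ?_)
      rw [Real.sqrt_mul hKc0]
      congr 1
      rw [Real.sqrt_eq_rpow, ← Real.rpow_mul (by positivity)]
      norm_num
    have hT : (Tj p (j + 1) A A' : ℝ) ≤ ∑ q ∈ gpairs B1 B2, ∑ q' ∈ gpairs B1 B2,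
        (if q.1 + q.2 = q'.1 + q'.2 then
          (prs (Gj p j (A1 q.1) (A2 q.2)) (Gj p j (A1 q'.1) (A2 q'.2))
            (fun z => resid p j (z.1 + z.2)) (fun z => resid p j (z.1 + z.2)) : ℝ) else 0) := by
      rw [← Finset.sum_product']
      conv_lhs => unfold Tj prs
      rw [Finset.card_eq_sum_card_fiberwise
        (f := fun z => ((red (p j) z.1.1, red (p j) z.1.2), (red (p j) z.2.1, red (p j) z.2.2)))
        (t := gpairs B1 B2 ×ˢ gpairs B1 B2)]
      · push_cast
        apply Finset.sum_le_sum
        rintro ⟨q, q'⟩ hq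
        split_ifs with hsum
        · norm_cast
          unfold prs
          apply card_le_card
          intro z hz
          simp only [mem_filter, mem_product, mem_Gj, Prod.ext_iff] at hz
          simp only [mem_filter, mem_product, mem_Gj, hA1, hA2]
          obtain ⟨⟨⟨⟨a1, a2, a3⟩, a4, a5, a6⟩, a7⟩, ⟨b1, b2⟩, b3, b4⟩ := hz
          refine ⟨⟨⟨⟨a1, b1⟩, ⟨a2, b2⟩, fun i hi => a3 i (by omega)⟩,
            ⟨a4, b3⟩, ⟨a5, b4⟩, fun i hi => a6 i (by omega)⟩, ?_⟩
          exact ((resid_succ_iff _ _ _ _).1 a7).1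
        · norm_cast
          rw [Nat.le_zero, Finset.card_eq_zero, Finset.filter_eq_empty_iff]
          intro z hz hz'
          apply hsum
          simp only [mem_filter, mem_product] at hz
          have := ((resid_succ_iff _ _ _ _).1 hz.2).2
          rw [red_add, red_add] at this
          rw [← hz']
          exact this
      · intro z hz
        simp only [coe_filter, mem_product, mem_Gj, Set.mem_ofPred_eq] at hz
        simp only [coe_product, Set.mem_prod, mem_coe, mem_gpairs]
        obtain ⟨⟨⟨a1, a2, a3⟩, a4, a5, a6⟩, a7⟩ := hz
        exact ⟨⟨mem_image_of_mem _ a1, mem_image_of_mem _ a2, a3 j (by omega)⟩,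
          mem_image_of_mem _ a4, mem_image_of_mem _ a5, a6 j (by omega)⟩
    refine hT.trans ?_
    have hstep : ∑ q ∈ gpairs B1 B2, ∑ q' ∈ gpairs B1 B2,
        (if q.1 + q.2 = q'.1 + q'.2 then
          (prs (Gj p j (A1 q.1) (A2 q.2)) (Gj p j (A1 q'.1) (A2 q'.2))
            (fun z => resid p j (z.1 + z.2)) (fun z => resid p j (z.1 + z.2)) : ℝ) else 0) ≤
        Kc * ∑ q ∈ gpairs B1 B2, ∑ q' ∈ gpairs B1 B2, (if q.1 + q.2 = q'.1 + q'.2 then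
      ((#(A1 q.1) : ℝ) * #(A2 q.2)) ^ (5 / 8 : ℝ) * ((#(A1 q'.1) : ℝ) * #(A2 q'.2)) ^ (5 / 8 : ℝ)
        else 0) := by
      rw [Finset.mul_sum]
      apply Finset.sum_le_sum
      intro q _
      rw [Finset.mul_sum]
      apply Finset.sum_le_sum
      intro q' _
      split_ifs
      · refine (prs_cs_real _ _ _ _).trans ?_
        refine (mul_le_mul (hIH q) (hIH q') (Real.sqrt_nonneg _) (by positivity)).trans
          (le_of_eq ?_)
        have := Real.mul_self_sqrt hKc0
        linear_combination ((#(A1 q.1) : ℝ) * #(A2 q.2)) ^ (5 / 8 : ℝ) *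
          ((#(A1 q'.1) : ℝ) * #(A2 q'.2)) ^ (5 / 8 : ℝ) * this
      · simp
    refine hstep.trans ?_
    refine (mul_le_mul_of_nonneg_left hw hKc0).trans (le_of_eq ?_)
    rw [hKc]; ring

section levels
open Classical

/-- fiber of the residue map -/
def fib (p : ℕ → ℕ) (F : Finset (Fin 3 → ℤ)) (j : ℕ) (a : Fin 3 → ℤ) : Finset (Fin 3 → ℤ) :=
  {b ∈ F | resid p j b = resid p j a}

/-- level of a point -/
def lev (p : ℕ → ℕ) (F : Finset (Fin 3 → ℤ)) (L : ℝ) (a : Fin 3 → ℤ) : ℕ :=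
  sInf {j | (#(fib p F j a) : ℝ) ≤ L}

theorem resid_mono (p : ℕ → ℕ) {i j : ℕ} (hij : i ≤ j) {a b : Fin 3 → ℤ}
    (h : resid p j a = resid p j b) : resid p i a = resid p i b := by
  rw [resid_eq_iff] at *
  exact fun k hk => h k (by omega)

theorem fib_anti (p : ℕ → ℕ) (F : Finset (Fin 3 → ℤ)) {i j : ℕ} (hij : i ≤ j) (a : Fin 3 → ℤ) :
    fib p F j a ⊆ fib p F i a := by
  intro b hb
  simp only [fib, mem_filter] at *
  exact ⟨hb.1, resid_mono p hij hb.2⟩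

variable (p : ℕ → ℕ) (F : Finset (Fin 3 → ℤ)) (L : ℝ) (J : ℕ)

theorem lev_le (hL : 1 ≤ L) (hinj : ∀ a ∈ F, ∀ b ∈ F, resid p J a = resid p J b → a = b)
    {a : Fin 3 → ℤ} (ha : a ∈ F) : lev p F L a ≤ J := by
  apply Nat.sInf_le
  have : #(fib p F J a) ≤ 1 := by
    rw [card_le_one]
    intro b hb c hc
    simp only [fib, mem_filter] at hb hc
    exact hinj b hb.1 c hc.1 (hb.2.trans hc.2.symm)
  have h : (#(fib p F J a) : ℝ) ≤ 1 := by exact_mod_cast this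
  exact h.trans hL

theorem lev_light (hL : 1 ≤ L) (hinj : ∀ a ∈ F, ∀ b ∈ F, resid p J a = resid p J b → a = b)
    {a : Fin 3 → ℤ} (ha : a ∈ F) {j : ℕ} (hj : lev p F L a ≤ j) : (#(fib p F j a) : ℝ) ≤ L := by
  have hne : {j | (#(fib p F j a) : ℝ) ≤ L}.Nonempty := by
    refine ⟨J, ?_⟩
    have : #(fib p F J a) ≤ 1 := by
      rw [card_le_one]
      intro b hb c hc
      simp only [fib, mem_filter] at hb hc
      exact hinj b hb.1 c hc.1 (hb.2.trans hc.2.symm)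
    have h : (#(fib p F J a) : ℝ) ≤ 1 := by exact_mod_cast this
    exact h.trans hL
  have := Nat.sInf_mem hne
  refine le_trans ?_ this
  exact_mod_cast card_le_card (fib_anti p F hj a)

theorem lev_heavy {a : Fin 3 → ℤ} {j : ℕ} (hj : lev p F L a = j + 1) : L < #(fib p F j a) := by
  by_contra h
  push Not at h
  have : lev p F L a ≤ j := Nat.sInf_le h
  omega

theorem color_count (k P : ℝ) (hk : 1 ≤ k) (hP : 1 ≤ P) (hL : L = #F / k) (hL1 : 1 ≤ L)
    (hp : ∀ i, (p i).Prime) (hpP : ∀ i < J, (p i : ℝ) ≤ P)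
    (hinj : ∀ a ∈ F, ∀ b ∈ F, resid p J a = resid p J b → a = b) :
    (#(F.image (fun a => (lev p F L a, resid p (lev p F L a) a))) : ℝ) ≤ (J + 1) * (k * P ^ 3) := by
  have hkP : 1 ≤ k * P ^ 3 := by
    have : 1 ≤ P ^ 3 := one_le_pow₀ hP
    nlinarith
  rw [Finset.card_eq_sum_card_fiberwise (f := fun z => z.1) (t := range (J + 1))]
  · push_cast
    have : ∀ j ∈ range (J + 1), (#{z ∈ F.image (fun a => (lev p F L a, resid p (lev p F L a) a)) |
        z.1 = j} : ℝ) ≤ k * P ^ 3 := by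
      intro j hj
      rw [mem_range] at hj
      rcases j with _ | i
      · refine le_trans ?_ hkP
        norm_cast
        rw [card_le_one]
        intro z hz w hw
        simp only [mem_filter, mem_image] at hz hw
        obtain ⟨⟨a, _, rfl⟩, ha⟩ := hz
        obtain ⟨⟨b, _, rfl⟩, hb⟩ := hw
        simp only at ha hb
        rw [ha, hb]
        simp only [Prod.mk.injEq, true_and]
        rw [resid_eq_iff]
        intro i hi
        omega
      · have : NeZero (p i) := ⟨(hp i).ne_zero⟩
        set H := {a ∈ F | L < #(fib p F i a)}.image (resid p i) with hH
        have hHL : (#H : ℝ) * L ≤ #F := by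
          have h1 : ∑ v ∈ H, (#{b ∈ F | resid p i b = v} : ℝ) ≤ #F := by
            have h2 : ∑ v ∈ H, #{b ∈ F | resid p i b = v} ≤ #F := by
              rw [← Finset.card_biUnion]
              · apply card_le_card
                intro b hb
                simp only [mem_biUnion, mem_filter] at hb
                obtain ⟨_, _, h, _⟩ := hb
                exact h
              · intro v _ w _ hvw
                rw [Function.onFun, Finset.disjoint_left]
                intro b hb hb'
                simp only [mem_filter] at hb hb'
                exact hvw (hb.2.symm.trans hb'.2)
            exact_mod_cast h2
          refine le_trans ?_ h1
          rw [← nsmul_eq_mul]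
          apply Finset.card_nsmul_le_sum
          intro v hv
          obtain ⟨a, ha, rfl⟩ := mem_image.1 hv
          exact (mem_filter.1 ha).2.le
        have hHk : (#H : ℝ) ≤ k := by
          rw [hL] at hHL hL1
          have hk0 : 0 < k := by linarith
          rw [mul_div_assoc', div_le_iff₀ hk0] at hHL
          have hF0 : 0 < (#F : ℝ) := by
            rw [le_div_iff₀ hk0] at hL1; linarith
          have : (#F : ℝ) * #H ≤ #F * k := by linarith
          exact le_of_mul_le_mul_left this hF0
        have hcard : #{z ∈ F.image (fun a => (lev p F L a, resid p (lev p F L a) a)) |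
            z.1 = i + 1} ≤ #(H ×ˢ (univ : Finset (Fin 3 → ZMod (p i)))) := by
          apply Finset.card_le_card_of_injOn
            (fun z => ((fun i' => if i' < i then z.2 i' else 0), z.2 i))
          · intro z hz
            simp only [coe_filter, mem_image, Set.mem_ofPred_eq] at hz
            obtain ⟨⟨a, ha, rfl⟩, hz1⟩ := hz
            simp only at hz1
            simp only [coe_product, Set.mem_prod, mem_coe, coe_univ, Set.mem_univ, and_true]
            rw [hH, mem_image]
            refine ⟨a, mem_filter.2 ⟨ha, lev_heavy p F L hz1⟩, ?_⟩
            funext i'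
            simp only [resid, hz1]
            split_ifs <;> first | rfl | omega
          · intro z hz w hw hzw
            simp only [coe_filter, mem_image, Set.mem_ofPred_eq] at hz hw
            obtain ⟨⟨a, ha, rfl⟩, hz1⟩ := hz
            obtain ⟨⟨b, hb, rfl⟩, hw1⟩ := hw
            simp only at hz1 hw1
            simp only [hz1, hw1, Prod.mk.injEq, true_and] at hzw ⊢
            obtain ⟨e1, e2⟩ := hzw
            rw [resid_succ_iff]
            constructor
            · rw [resid_eq_iff]
              intro i' hi'
              have := congrFun e1 i'
              simpa [hi', resid, show i' < i + 1 by omega] using this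
            · simpa [resid] using e2
        have hu : (#(univ : Finset (Fin 3 → ZMod (p i))) : ℝ) = (p i : ℝ) ^ 3 := by
          simp [ZMod.card]
        calc _ ≤ ((#(H ×ˢ (univ : Finset (Fin 3 → ZMod (p i)))) : ℕ) : ℝ) := by exact_mod_cast hcard
          _ = #H * (p i : ℝ) ^ 3 := by rw [card_product]; push_cast; rw [hu]
          _ ≤ k * P ^ 3 := by
            have := hpP i (by omega)
            gcongr
    have := Finset.sum_le_card_nsmul _ _ _ this
    rw [card_range, nsmul_eq_mul] at this
    push_cast at this
    exact this
  · intro z hz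
    simp only [coe_image, Set.mem_image, mem_coe] at hz
    obtain ⟨a, ha, rfl⟩ := hz
    simp only [coe_range, Set.mem_Iio]
    have := lev_le p F L J hL1 hinj ha
    omega

/-- good tuples -/
def GT (p : ℕ → ℕ) (F : Finset (Fin 3 → ℤ)) (J s : ℕ) : Finset (Fin s → Fin 3 → ℤ) :=
  {X ∈ tup s F | ∀ i i', i ≠ i' → gdj p J (X i) (X i')}

/-- count of pairs of reduced tuples -/
theorem U_bound (j u : ℕ) (A : Finset (Fin 3 → ℤ)) :
    #{q ∈ GT p A j (u + 2) ×ˢ GT p A j (u + 2) | resid p j (∑ i, q.1 i) = resid p j (∑ i, q.2 i)}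
      ≤ #A ^ (2 * u) * Tj p j A A := by
  have hcard : #A ^ (2 * u) = #(tup u A ×ˢ tup u A) := by
    rw [card_product, card_tup]; ring
  rw [hcard, mul_comm]
  apply Finset.card_le_mul_card_image_of_maps_to
    (f := fun q => (rmv 0 (rmv 0 q.1), rmv 0 (rmv 0 q.2)))
  · intro q hq
    simp only [mem_filter, mem_product, GT, mem_tup] at hq
    simp only [mem_product, mem_tup, rmv]
    exact ⟨fun i => hq.1.1.1 _, fun i => hq.1.2.1 _⟩
  · rintro ⟨X', Y'⟩ _
    have h1 : #{q ∈ {q ∈ GT p A j (u + 2) ×ˢ GT p A j (u + 2) |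
        resid p j (∑ i, q.1 i) = resid p j (∑ i, q.2 i)} |
        (rmv 0 (rmv 0 q.1), rmv 0 (rmv 0 q.2)) = (X', Y')} ≤
        prs (Gj p j A A) (Gj p j A A) (fun q => resid p j (q.1 + q.2) + resid p j (∑ i, X' i))
          (fun q => resid p j (q.1 + q.2) + resid p j (∑ i, Y' i)) := by
      unfold prs
      apply Finset.card_le_card_of_injOn (fun q => ((q.1 0, q.1 1), (q.2 0, q.2 1)))
      · intro q hq
        simp only [coe_filter, mem_filter, mem_product, GT, mem_tup, Set.mem_ofPred_eq,
          Prod.mk.injEq] at hq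
        obtain ⟨⟨⟨⟨a1, a2⟩, b1, b2⟩, h⟩, e1, e2⟩ := hq
        simp only [coe_filter, mem_product, mem_Gj, Set.mem_ofPred_eq]
        refine ⟨⟨⟨a1 0, a1 1, a2 0 1 (by simp)⟩, b1 0, b1 1, b2 0 1 (by simp)⟩, ?_⟩
        rw [← resid_add, ← resid_add, ← e1, ← e2]
        rw [Fin.sum_univ_succ, Fin.sum_univ_succ, Fin.sum_univ_succ (f := q.2),
          Fin.sum_univ_succ (n := u), ← add_assoc, ← add_assoc] at h
        simpa [rmv] using h
      · intro q hq r hr hqr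
        simp only [coe_filter, mem_filter, Set.mem_ofPred_eq, Prod.mk.injEq] at hq hr hqr
        apply Prod.ext
        · exact rmv_ext 0 (rmv_ext 0 (hq.2.1.trans hr.2.1.symm) (by simpa [rmv] using hqr.1.2)) hqr.1.1
        · exact rmv_ext 0 (rmv_ext 0 (hq.2.2.trans hr.2.2.symm) (by simpa [rmv] using hqr.2.2)) hqr.2.1
    have h2 := prs_cs (Gj p j A A) (Gj p j A A)
      (fun q => resid p j (q.1 + q.2) + resid p j (∑ i, X' i))
      (fun q => resid p j (q.1 + q.2) + resid p j (∑ i, Y' i))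
    have h3 : ∀ c, prs (Gj p j A A) (Gj p j A A)
      (fun q => resid p j (q.1 + q.2) + c) (fun q => resid p j (q.1 + q.2) + c) = Tj p j A A := by
      intro c
      unfold Tj prs
      simp
    rw [h3, h3, ← sq] at h2
    exact h1.trans ((Nat.pow_le_pow_iff_left two_ne_zero).1 h2)

/-- off-diagonal contribution at a given level -/
theorem off_bound (j u : ℕ) (i : Fin (u + 3)) (hjJ : j ≤ J) (Cc : ℝ)
    (hC : ∀ d : Fin 3 → ℤ, d ≠ 0 → (#{a ∈ F | a - d ∈ F} : ℝ) ≤ Cc) :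
    (#{q ∈ GT p F J (u + 3) ×ˢ GT p F J (u + 3) | (∑ l, q.1 l = ∑ l, q.2 l) ∧
      resid p j (q.1 i) = resid p j (q.2 i) ∧ q.1 i ≠ q.2 i ∧ (∀ l, lev p F L (q.1 l) ≤ j) ∧
      (∀ l, lev p F L (q.2 l) ≤ j)} : ℝ) ≤
      Cc * (#{a ∈ F | lev p F L a ≤ j} ^ (2 * u) *
        Tj p j {a ∈ F | lev p F L a ≤ j} {a ∈ F | lev p F L a ≤ j} : ℕ) := by
  set A := {a ∈ F | lev p F L a ≤ j} with hA
  set M := {q ∈ GT p F J (u + 3) ×ˢ GT p F J (u + 3) | (∑ l, q.1 l = ∑ l, q.2 l) ∧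
      resid p j (q.1 i) = resid p j (q.2 i) ∧ q.1 i ≠ q.2 i ∧ (∀ l, lev p F L (q.1 l) ≤ j) ∧
      (∀ l, lev p F L (q.2 l) ≤ j)} with hM
  set U := {q ∈ GT p A j (u + 2) ×ˢ GT p A j (u + 2) |
    resid p j (∑ i, q.1 i) = resid p j (∑ i, q.2 i)} with hU
  have hmM : ∀ q ∈ M, ((∀ l, q.1 l ∈ F) ∧ (∀ l l', l ≠ l' → gdj p J (q.1 l) (q.1 l'))) ∧
      ((∀ l, q.2 l ∈ F) ∧ (∀ l l', l ≠ l' → gdj p J (q.2 l) (q.2 l'))) ∧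
      (∑ l, q.1 l = ∑ l, q.2 l) ∧
      resid p j (q.1 i) = resid p j (q.2 i) ∧ q.1 i ≠ q.2 i ∧ (∀ l, lev p F L (q.1 l) ≤ j) ∧
      (∀ l, lev p F L (q.2 l) ≤ j) := by
    intro q hq
    simp only [hM, mem_filter, mem_product, GT, mem_tup] at hq
    obtain ⟨⟨h1, h2⟩, h3⟩ := hq
    exact ⟨h1, h2, h3⟩
  have hfib : (#M : ℝ) ≤ Cc * #U := by
    rw [Finset.card_eq_sum_card_fiberwise (f := fun q => (rmv i q.1, rmv i q.2)) (t := U)]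
    · push_cast
      rw [mul_comm, ← nsmul_eq_mul]
      apply Finset.sum_le_card_nsmul
      rintro ⟨X', Y'⟩ _
      by_cases hd : ∑ l, Y' l - ∑ l, X' l = 0
      · have hempty : {q ∈ M | (rmv i q.1, rmv i q.2) = (X', Y')} = ∅ := by
          rw [Finset.filter_eq_empty_iff]
          intro q hq he
          obtain ⟨_, _, h3, _, h5, _⟩ := hmM q hq
          simp only [Prod.mk.injEq] at he
          rw [Fin.sum_univ_succAbove _ i, Fin.sum_univ_succAbove (f := q.2) i] at h3
          rw [← he.1, ← he.2] at hd
          simp only [rmv] at hd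
          rw [sub_eq_zero.1 hd] at h3
          exact h5 (add_right_cancel h3)
        rw [hempty]
        have := hC (fun _ => 1) (by intro h; have := congrFun h 0; simp at this)
        simp only [card_empty, Nat.cast_zero]
        exact le_trans (by positivity) this
      · refine le_trans ?_ (hC _ hd)
        norm_cast
        apply Finset.card_le_card_of_injOn (fun q => q.1 i)
        · intro q hq
          simp only [coe_filter, Set.mem_ofPred_eq, Prod.mk.injEq] at hq
          obtain ⟨h1, h2, h3, _⟩ := hmM q hq.1
          simp only [coe_filter, Set.mem_ofPred_eq]
          refine ⟨h1.1 i, ?_⟩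
          rw [← hq.2.1, ← hq.2.2]
          rw [Fin.sum_univ_succAbove _ i, Fin.sum_univ_succAbove (f := q.2) i] at h3
          have : q.1 i - (∑ l, rmv i q.2 l - ∑ l, rmv i q.1 l) = q.2 i := by
            simp only [rmv]
            rw [sub_sub_eq_add_sub, h3, add_sub_cancel_right]
          rw [this]
          exact h2.1 i
        · intro q hq r hr hqr
          simp only [coe_filter, Set.mem_ofPred_eq, Prod.mk.injEq] at hq hr
          simp only at hqr
          have e1 : q.1 = r.1 := rmv_ext i (hq.2.1.trans hr.2.1.symm) hqr
          have e2 : rmv i q.2 = rmv i r.2 := hq.2.2.trans hr.2.2.symm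
          apply Prod.ext e1
          apply rmv_ext i e2
          have s1 := (hmM q hq.1).2.2.1
          have s2 := (hmM r hr.1).2.2.1
          rw [e1] at s1
          have s3 := s1.symm.trans s2
          rw [Fin.sum_univ_succAbove _ i, Fin.sum_univ_succAbove (f := r.2) i] at s3
          have s4 : ∑ l, q.2 (i.succAbove l) = ∑ l, r.2 (i.succAbove l) := by
            have := congrArg (fun X : Fin (u + 2) → Fin 3 → ℤ => ∑ l, X l) e2
            simpa only [rmv] using this
          rw [s4] at s3
          exact add_right_cancel s3
    · intro q hq
      obtain ⟨h1, h2, h3, h4, h5, h6, h7⟩ := hmM q hq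
      simp only [hU, coe_filter, mem_product, GT, mem_filter, mem_tup, Set.mem_ofPred_eq, hA, rmv]
      have hsi : ∀ l l' : Fin (u + 2), l ≠ l' → i.succAbove l ≠ i.succAbove l' :=
        fun l l' h h' => h (Fin.succAbove_right_injective h')
      refine ⟨⟨⟨fun l => ⟨h1.1 _, h6 _⟩, fun l l' hll k hk => h1.2 _ _ (hsi l l' hll) k (by omega)⟩,
        ⟨fun l => ⟨h2.1 _, h7 _⟩, fun l l' hll k hk => h2.2 _ _ (hsi l l' hll) k (by omega)⟩⟩, ?_⟩
      rw [Fin.sum_univ_succAbove _ i, Fin.sum_univ_succAbove (f := q.2) i] at h3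
      have := congrArg (resid p j) h3
      rw [resid_add, resid_add, h4] at this
      exact add_left_cancel this
  refine hfib.trans ?_
  have hC0 : 0 ≤ Cc := le_trans (by positivity)
    (hC (fun _ => 1) (by intro h; have := congrFun h 0; simp at this))
  have := U_bound p j u A
  gcongr

theorem levels_main (m : ℤ) (l u : ℕ) (hl : 1 ≤ l) (k P Cc : ℝ) (hk : 1 ≤ k) (hkn : k ≤ #F)
    (hP : 1 ≤ P)
    (hp : ∀ i, (p i).Prime ∧ p i ≠ 2) (hpP : ∀ i < J, (p i : ℝ) ≤ P)
    (hinj : ∀ a ∈ F, ∀ b ∈ F, resid p J a = resid p J b → a = b)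
    (hF : ∀ a ∈ F, dt a a = m) (hFl : #F < 2 ^ l)
    (hC : ∀ d : Fin 3 → ℤ, d ≠ 0 → (#{a ∈ F | a - d ∈ F} : ℝ) ≤ Cc) :
    (prs (GT p F J (u + 3)) (GT p F J (u + 3)) (fun X => ∑ i, X i) (fun X => ∑ i, X i) : ℝ) ≤
      ((u + 3) * ((J + 1) * (k * P ^ 3))) * ((u + 3) * (#F * en (u + 2) F +
        (J + 1) * (Cc * ((#F : ℝ) ^ (2 * u) * ((32 * (l : ℝ) ^ 4) ^ J *
          ((#F : ℝ) / k) ^ (3 / 2 : ℝ) * ((#F : ℝ) * #F) ^ (5 / 4 : ℝ)))))) := by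
  have hk0 : 0 < k := by linarith
  set L : ℝ := #F / k with hL
  have hL1 : 1 ≤ L := by rw [hL, le_div_iff₀ hk0]; linarith
  have htop : ∀ X : Fin (u + 3) → Fin 3 → ℤ, ∃ i, ∀ i', lev p F L (X i') ≤ lev p F L (X i) := by
    intro X
    obtain ⟨i, _, hi⟩ := Finset.exists_max_image univ (fun i => lev p F L (X i)) ⟨0, mem_univ _⟩
    exact ⟨i, fun i' => hi i' (mem_univ _)⟩
  choose top htop using htop
  set D := F.image (fun a => (lev p F L a, resid p (lev p F L a) a)) with hD
  have hmem : ∀ X ∈ GT p F J (u + 3), ∀ i, X i ∈ F := by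
    intro X hX
    simp only [GT, mem_filter, mem_tup] at hX
    exact hX.1
  have hcol := prs_color (GT p F J (u + 3)) (fun X => ∑ i, X i)
    (fun X => (top X, (lev p F L (X (top X)), resid p (lev p F L (X (top X))) (X (top X)))))
    ((univ : Finset (Fin (u + 3))) ×ˢ D) (by
      intro X hX
      rw [mem_product]
      exact ⟨mem_univ _, mem_image_of_mem _ (hmem X hX _)⟩)
  have hDc := color_count p F L J k P hk hP hL hL1 (fun i => (hp i).1) hpP hinj
  rw [← hD] at hDc
  set N := {q ∈ GT p F J (u + 3) ×ˢ GT p F J (u + 3) | ∑ i, q.1 i = ∑ i, q.2 i ∧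
    (top q.1, (lev p F L (q.1 (top q.1)), resid p (lev p F L (q.1 (top q.1))) (q.1 (top q.1)))) =
    (top q.2, (lev p F L (q.2 (top q.2)), resid p (lev p F L (q.2 (top q.2))) (q.2 (top q.2))))}
    with hN
  set Bd : ℝ := Cc * ((#F : ℝ) ^ (2 * u) * ((32 * (l : ℝ) ^ 4) ^ J *
          L ^ (3 / 2 : ℝ) * ((#F : ℝ) * #F) ^ (5 / 4 : ℝ))) with hBd
  have hC0 : 0 ≤ Cc := le_trans (by positivity)
    (hC (fun _ => 1) (by intro h; have := congrFun h 0; simp at this))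
  have hlev : ∀ a ∈ F, lev p F L a ≤ J := fun a ha => lev_le p F L J hL1 hinj ha
  have hNb : (#N : ℝ) ≤ (u + 3) * (#F * en (u + 2) F + (J + 1) * Bd) := by
    rw [Finset.card_eq_sum_card_fiberwise (f := fun q => top q.1) (t := univ)
      (fun _ _ => by simp)]
    push_cast
    have hi : ∀ i ∈ (univ : Finset (Fin (u + 3))), (#{q ∈ N | top q.1 = i} : ℝ) ≤
        #F * en (u + 2) F + (J + 1) * Bd := by
      intro i _
      rw [← Finset.card_filter_add_card_filter_not (s := {q ∈ N | top q.1 = i})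
        (fun q => q.1 i = q.2 i)]
      push_cast
      apply add_le_add
      · have := en_fix_coord (u + 2) F i
        have h2 : #{q ∈ {q ∈ N | top q.1 = i} | q.1 i = q.2 i} ≤ #F * en (u + 2) F := by
          refine le_trans ?_ this
          apply card_le_card
          intro q hq
          simp only [mem_filter, hN, mem_product, mem_tup] at hq ⊢
          exact ⟨⟨hmem _ hq.1.1.1.1, hmem _ hq.1.1.1.2⟩, hq.1.1.2.1, hq.2⟩
        exact_mod_cast h2
      · rw [Finset.card_eq_sum_card_fiberwise (f := fun q => lev p F L (q.1 i)) (t := range (J + 1))]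
        · push_cast
          have hj : ∀ j ∈ range (J + 1), (#{q ∈ {q ∈ {q ∈ N | top q.1 = i} | ¬ q.1 i = q.2 i} |
              lev p F L (q.1 i) = j} : ℝ) ≤ Bd := by
            intro j hj
            have hjJ : j ≤ J := by rw [mem_range] at hj; omega
            have h1 := off_bound p F L J j u i hjJ Cc hC
            set A := {a ∈ F | lev p F L a ≤ j} with hA
            have hAF : #A ≤ #F := card_le_card (filter_subset _ _)
            have hAf : ∀ a ∈ A, (#{b ∈ A | resid p j b = resid p j a} : ℝ) ≤ L := by
              intro a ha
              have ha' := mem_filter.1 ha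
              refine le_trans ?_ (lev_light p F L J hL1 hinj ha'.1 ha'.2)
              norm_cast
              apply card_le_card
              intro b hb
              simp only [fib, mem_filter, hA] at hb ⊢
              exact ⟨hb.1.1, hb.2⟩
            have h2 := T_bound p hp m l L (by linarith) j A A
              (fun a ha => hF a (mem_filter.1 ha).1) (fun a ha => hF a (mem_filter.1 ha).1)
              (hAF.trans_lt hFl) (hAF.trans_lt hFl) hAf hAf
            refine le_trans ?_ (h1.trans ?_)
            · norm_cast
              apply card_le_card
              intro q hq
              simp only [mem_filter, hN, Prod.mk.injEq] at hq
              obtain ⟨⟨⟨⟨a1, a2, a3, a4, a5⟩, a6⟩, a7⟩, a8⟩ := hq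
              have a9 : top q.2 = i := a3.symm.trans a6
              rw [a6, a9] at a4
              rw [a6, a9, ← a4, a8] at a5
              simp only [mem_filter]
              refine ⟨a1, a2, a5, a7, fun l => ?_, fun l => ?_⟩
              · have := htop q.1 l
                rwa [a6, a8] at this
              · have := htop q.2 l
                rwa [a9, ← a4, a8] at this
            · rw [hBd]
              push_cast
              have hAFR : (#A : ℝ) ≤ #F := by exact_mod_cast hAF
              have hl1 : (1 : ℝ) ≤ l := by exact_mod_cast hl
              have hK : (1 : ℝ) ≤ 32 * (l : ℝ) ^ 4 := by
                have : (1 : ℝ) ≤ (l : ℝ) ^ 4 := one_le_pow₀ hl1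
                linarith
              have hLp : 0 ≤ L := by linarith
              have h3 : (Tj p j A A : ℝ) ≤ (32 * (l : ℝ) ^ 4) ^ J *
                  L ^ (3 / 2 : ℝ) * ((#F : ℝ) * #F) ^ (5 / 4 : ℝ) := by
                refine h2.trans ?_
                have : (32 * (l : ℝ) ^ 4) ^ j ≤ (32 * (l : ℝ) ^ 4) ^ J := pow_le_pow_right₀ hK hjJ
                gcongr
              gcongr
          have := Finset.sum_le_card_nsmul _ _ _ hj
          rw [card_range, nsmul_eq_mul] at this
          push_cast at this
          exact this
        · intro q hq
          simp only [coe_filter, mem_filter, hN, mem_product, Set.mem_ofPred_eq] at hq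
          have := hlev _ (hmem _ hq.1.1.1.1 i)
          simp only [coe_range, Set.mem_Iio]
          omega
    have := Finset.sum_le_card_nsmul _ _ _ hi
    rw [card_univ, Fintype.card_fin, nsmul_eq_mul] at this
    push_cast at this
    exact this
  have hcolR : (prs (GT p F J (u + 3)) (GT p F J (u + 3)) (fun X => ∑ i, X i)
      (fun X => ∑ i, X i) : ℝ) ≤ #((univ : Finset (Fin (u + 3))) ×ˢ D) * #N := by
    exact_mod_cast hcol
  refine hcolR.trans ?_
  apply mul_le_mul _ hNb (by positivity) (by positivity)
  rw [card_product, card_univ, Fintype.card_fin]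
  push_cast
  gcongr
end levels

theorem prime_seq (Q : ℕ) (hQ : 2 ≤ Q) : ∃ pr : ℕ → ℕ, StrictMono pr ∧
    ∀ i, (pr i).Prime ∧ Q < pr i ∧ pr i ≤ 2 ^ (i + 1) * Q := by
  have hb : ∀ n : ℕ, ∃ q : ℕ, n ≠ 0 → q.Prime ∧ n < q ∧ q ≤ 2 * n := by
    intro n
    by_cases hn : n = 0
    · exact ⟨0, fun h => absurd hn h⟩
    · obtain ⟨q, h⟩ := Nat.exists_prime_lt_and_le_two_mul n hn
      exact ⟨q, fun _ => h⟩
  choose nx hnx using hb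
  let pr : ℕ → ℕ := fun i => Nat.rec (nx Q) (fun _ r => nx r) i
  have h0 : pr 0 = nx Q := rfl
  have hS : ∀ i, pr (i + 1) = nx (pr i) := fun i => rfl
  have key : ∀ i, (pr i).Prime ∧ Q < pr i ∧ pr i ≤ 2 ^ (i + 1) * Q := by
    intro i
    induction i with
    | zero =>
      have := hnx Q (by omega)
      rw [h0]
      refine ⟨this.1, this.2.1, by simpa using this.2.2⟩
    | succ i ih =>
      have := hnx (pr i) (by omega)
      rw [hS]
      refine ⟨this.1, by omega, this.2.2.trans ?_⟩
      rw [pow_succ]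
      nlinarith [ih.2.2]
  refine ⟨pr, strictMono_nat_of_lt_succ fun i => ?_, key⟩
  have := hnx (pr i) (by have := key i; omega)
  rw [hS]
  exact this.2.1

theorem few_factors {Q T N : ℕ} (hQ : 2 ≤ Q) (hN : N ≠ 0) (hNT : N ≤ Q ^ T) {pr : ℕ → ℕ}
    (hm : StrictMono pr) (hp : ∀ i, (pr i).Prime ∧ Q < pr i) (S : Finset ℕ)
    (hS : ∀ i ∈ S, pr i ∣ N) : #S ≤ T := by
  have hd : ∏ i ∈ S, pr i ∣ N := by
    apply Finset.prod_dvd_of_isRelPrime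
    · intro i _ j _ hij
      exact Nat.coprime_iff_isRelPrime.1
        ((Nat.coprime_primes (hp i).1 (hp j).1).mpr (hm.injective.ne hij))
    · exact hS
  have h1 : Q ^ #S ≤ ∏ i ∈ S, pr i := by
    rw [← Finset.prod_const]
    exact Finset.prod_le_prod' fun i _ => (hp i).2.le
  have h2 : Q ^ #S ≤ Q ^ T := h1.trans ((Nat.le_of_dvd (Nat.pos_of_ne_zero hN) hd).trans hNT)
  exact (Nat.pow_le_pow_iff_right (by omega)).1 h2

theorem good_group {ι : Type*} [Fintype ι] [DecidableEq ι] {Q T : ℕ} (hQ : 2 ≤ Q) (v : ι → ℕ)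
    (hv : ∀ x, v x ≠ 0 ∧ v x ≤ Q ^ T) {pr : ℕ → ℕ}
    (hm : StrictMono pr) (hp : ∀ i, (pr i).Prime ∧ Q < pr i) (J G : ℕ)
    (hG : Fintype.card ι * T < G) :
    ∃ g ∈ range G, ∀ i < J, ∀ x, ¬ pr (g * J + i) ∣ v x := by
  by_contra hcon
  push Not at hcon
  have hc : ∀ g : ℕ, ∃ ix : ℕ × ι, g ∈ range G → ix.1 < J ∧ pr (g * J + ix.1) ∣ v ix.2 := by
    by_cases hne : Nonempty ι
    · intro g
      by_cases hg : g ∈ range G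
      · obtain ⟨i, hi, x, hx⟩ := hcon g hg
        exact ⟨(i, x), fun _ => ⟨hi, hx⟩⟩
      · exact ⟨(0, hne.some), fun h => absurd h hg⟩
    · obtain ⟨i, hi, x, hx⟩ := hcon 0 (by simp; omega)
      exact absurd ⟨x⟩ hne
  choose ix hix using hc
  obtain ⟨x, -, hx⟩ := Finset.exists_lt_card_fiber_of_mul_lt_card_of_maps_to
    (s := range G) (t := (univ : Finset ι)) (f := fun g => (ix g).2) (n := T)
    (fun _ _ => mem_univ _) (by simpa using hG)
  have hinj : Set.InjOn (fun g => g * J + (ix g).1) ({g ∈ range G | (ix g).2 = x} : Finset ℕ) := by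
    intro g hg g' hg' h
    simp only [coe_filter, Set.mem_ofPred_eq] at hg hg'
    have a1 := (hix g hg.1).1
    have a2 := (hix g' hg'.1).1
    simp only at h
    have e1 : (g * J + (ix g).1) / J = g := by
      rw [mul_comm, Nat.mul_add_div (by omega), Nat.div_eq_of_lt a1, add_zero]
    have e2 : (g' * J + (ix g').1) / J = g' := by
      rw [mul_comm, Nat.mul_add_div (by omega), Nat.div_eq_of_lt a2, add_zero]
    rw [← e1, ← e2, h]
  have := few_factors hQ (hv x).1 (hv x).2 hm hp
    (({g ∈ range G | (ix g).2 = x} : Finset ℕ).image (fun g => g * J + (ix g).1)) (by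
      intro i hi
      simp only [mem_image, mem_filter] at hi
      obtain ⟨g, ⟨hg, hgx⟩, rfl⟩ := hi
      rw [← hgx]
      exact (hix g hg).2)
  rw [card_image_of_injOn hinj] at this
  omega

theorem dt_self_nonneg (x : Fin 3 → ℤ) : 0 ≤ dt x x := by
  unfold dt; nlinarith [mul_self_nonneg (x 0), mul_self_nonneg (x 1), mul_self_nonneg (x 2)]

theorem dt_self_ne (x : Fin 3 → ℤ) (hx : x ≠ 0) : dt x x ≠ 0 := by
  intro h
  apply hx
  unfold dt at h
  have h0 := mul_self_nonneg (x 0)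
  have h1 := mul_self_nonneg (x 1)
  have h2 := mul_self_nonneg (x 2)
  funext c
  fin_cases c
  · exact mul_self_eq_zero.1 (by linarith : x 0 * x 0 = 0)
  · exact mul_self_eq_zero.1 (by linarith : x 1 * x 1 = 0)
  · exact mul_self_eq_zero.1 (by linarith : x 2 * x 2 = 0)

theorem dt_para (x y : Fin 3 → ℤ) : dt (x - y) (x - y) + dt (x + y) (x + y) =
    2 * dt x x + 2 * dt y y := by
  simp [dt]; ring

theorem red_sub (q : ℕ) (a b : Fin 3 → ℤ) : red q (a - b) = red q a - red q b := by
  funext c; simp [red]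

theorem gd_of_not_dvd (q : ℕ) (a b : Fin 3 → ℤ) (h1 : ¬ q ∣ (dt (a - b) (a - b)).natAbs)
    (h2 : ¬ q ∣ (dt (a + b) (a + b)).natAbs) : gd (red q a) (red q b) := by
  unfold gd
  rw [← red_sub, ← red_add, red_dt, red_dt]
  constructor
  · intro h
    rw [ZMod.intCast_zmod_eq_zero_iff_dvd] at h
    exact h1 (Int.natCast_dvd.1 h)
  · intro h
    rw [ZMod.intCast_zmod_eq_zero_iff_dvd] at h
    exact h2 (Int.natCast_dvd.1 h)

theorem resid_sep {Q T m : ℕ} (hQ : 2 ≤ Q) (hmQ : 4 * m ≤ Q ^ T) {p : ℕ → ℕ}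
    (hm : StrictMono p) (hp : ∀ i, (p i).Prime ∧ Q < p i) (a b : Fin 3 → ℤ)
    (ha : dt a a = m) (hb : dt b b = m) (h : resid p (T + 1) a = resid p (T + 1) b) : a = b := by
  rw [resid_eq_iff] at h
  have hpara := dt_para a b
  have hnn := dt_self_nonneg (a + b)
  have hle : dt (a - b) (a - b) ≤ 4 * m := by rw [ha, hb] at hpara; linarith
  have hcs : ∀ c, (a c - b c) * (a c - b c) ≤ 4 * m := by
    intro c
    refine le_trans ?_ hle
    unfold dt
    have h0 := mul_self_nonneg ((a - b) 0)
    have h1 := mul_self_nonneg ((a - b) 1)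
    have h2 := mul_self_nonneg ((a - b) 2)
    fin_cases c
    · change (a - b) 0 * (a - b) 0 ≤ _; linarith
    · change (a - b) 1 * (a - b) 1 ≤ _; linarith
    · change (a - b) 2 * (a - b) 2 ≤ _; linarith
  funext c
  by_contra hne
  have hN : (a c - b c).natAbs ≠ 0 := by omega
  have hNle : (a c - b c).natAbs ≤ Q ^ T := by
    refine le_trans ?_ hmQ
    have h1 : (((a c - b c).natAbs * (a c - b c).natAbs : ℕ) : ℤ) ≤ ((4 * m : ℕ) : ℤ) := by
      rw [Int.natAbs_mul_self]; push_cast; exact hcs c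
    have h2 : (a c - b c).natAbs * (a c - b c).natAbs ≤ 4 * m := by exact_mod_cast h1
    nlinarith [Nat.pos_of_ne_zero hN]
  have := few_factors hQ hN hNle hm hp (range (T + 1)) (by
    intro i hi
    have h3 := congrFun (h i (by simpa using hi)) c
    simp only [red] at h3
    have h4 : (((a c - b c : ℤ)) : ZMod (p i)) = 0 := by push_cast; rw [h3, sub_self]
    rw [ZMod.intCast_zmod_eq_zero_iff_dvd] at h4
    exact Int.natCast_dvd.1 h4)
  simp at this

section split
open Classical

theorem en_split {Q T m : ℕ} (hQ : 2 ≤ Q) (hmQ : 4 * m ≤ Q ^ T) (hQT : 1 ≤ Q ^ T) {pr : ℕ → ℕ}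
    (hm : StrictMono pr) (hp : ∀ i, (pr i).Prime ∧ Q < pr i) (F : Finset (Fin 3 → ℤ))
    (hF : ∀ a ∈ F, dt a a = m) (t J G : ℕ) (hG : 4 * (t + 1) ^ 2 * T < G) :
    en (t + 1) F ≤ 4 * (t + 1) ^ 2 * (#F * en t F) +
      ∑ g ∈ range G, prs (GT (fun i => pr (g * J + i)) F J (t + 1))
        (GT (fun i => pr (g * J + i)) F J (t + 1)) (fun X => ∑ i, X i) (fun X => ∑ i, X i) := by
  let ι := (Fin (t + 1) × Fin (t + 1)) × Bool × Bool
  let sd : Bool → ((Fin (t + 1) → Fin 3 → ℤ) × (Fin (t + 1) → Fin 3 → ℤ)) → (Fin (t + 1) → Fin 3 → ℤ) := fun b q => if b then q.1 else q.2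
  let τ : Bool → (Fin 3 → ℤ) → (Fin 3 → ℤ) := fun b x => if b then x else -x
  let D : ι → Finset ((Fin (t + 1) → Fin 3 → ℤ) × (Fin (t + 1) → Fin 3 → ℤ)) := fun x => {q ∈ tup (t + 1) F ×ˢ tup (t + 1) F |
    (∑ l, q.1 l = ∑ l, q.2 l) ∧ x.1.2 ≠ x.1.1 ∧ sd x.2.1 q x.1.2 = τ x.2.2 (sd x.2.1 q x.1.1)}
  let E : ℕ → Finset ((Fin (t + 1) → Fin 3 → ℤ) × (Fin (t + 1) → Fin 3 → ℤ)) := fun g => {q ∈ GT (fun i => pr (g * J + i)) F J (t + 1) ×ˢ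
    GT (fun i => pr (g * J + i)) F J (t + 1) | ∑ l, q.1 l = ∑ l, q.2 l}
  have hD : ∀ x, #(D x) ≤ #F * en t F := by
    rintro ⟨⟨i, j⟩, b, c⟩
    by_cases hij : j = i
    · have : D ((i, j), b, c) = ∅ := by simp [D, hij]
      rw [this]; simp
    · cases b
      · refine le_trans (card_le_card ?_) (en_two_coord' t F i j hij (τ c))
        intro q hq
        simp only [D, mem_filter, sd] at hq ⊢
        exact ⟨hq.1, hq.2.1, by simpa using hq.2.2.2⟩
      · refine le_trans (card_le_card ?_) (en_two_coord t F i j hij (τ c))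
        intro q hq
        simp only [D, mem_filter, sd] at hq ⊢
        exact ⟨hq.1, hq.2.1, by simpa using hq.2.2.2⟩
  have hcι : Fintype.card ι = 4 * (t + 1) ^ 2 := by
    simp [ι, Fintype.card_prod]; ring
  have hsub : ({q ∈ tup (t + 1) F ×ˢ tup (t + 1) F | ∑ l, q.1 l = ∑ l, q.2 l} : Finset ((Fin (t + 1) → Fin 3 → ℤ) × (Fin (t + 1) → Fin 3 → ℤ))) ⊆
      (univ : Finset ι).biUnion D ∪ (range G).biUnion E := by
    intro q hq
    by_cases hdeg : ∃ x, q ∈ D x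
    · obtain ⟨x, hx⟩ := hdeg
      exact mem_union_left _ (mem_biUnion.2 ⟨x, mem_univ _, hx⟩)
    · apply mem_union_right
      push Not at hdeg
      simp only [mem_filter, mem_product] at hq
      have hmem : ∀ b i, sd b q i ∈ F := by
        intro b i
        cases b
        · exact mem_tup.1 hq.1.2 i
        · exact mem_tup.1 hq.1.1 i
      have hnd : ∀ i j, j ≠ i → ∀ b c, sd b q j ≠ τ c (sd b q i) := by
        intro i j hij b c h
        apply hdeg ((i, j), b, c)
        simp only [D, mem_filter, mem_product]
        exact ⟨hq.1, hq.2, hij, h⟩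
      let v : ι → ℕ := fun x => if x.1.2 = x.1.1 then 1 else
        (dt (sd x.2.1 q x.1.2 - τ x.2.2 (sd x.2.1 q x.1.1))
          (sd x.2.1 q x.1.2 - τ x.2.2 (sd x.2.1 q x.1.1))).natAbs
      have hv : ∀ x, v x ≠ 0 ∧ v x ≤ Q ^ T := by
        rintro ⟨⟨i, j⟩, b, c⟩
        by_cases hij : j = i
        · simp only [v, hij, if_true]
          exact ⟨one_ne_zero, hQT⟩
        · simp only [v, hij, if_false]
          constructor
          · rw [Int.natAbs_ne_zero]
            exact dt_self_ne _ (sub_ne_zero.2 (hnd i j hij b c))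
          · refine le_trans ?_ hmQ
            have h1 := dt_para (sd b q j) (τ c (sd b q i))
            have h2 := dt_self_nonneg (sd b q j + τ c (sd b q i))
            have h3 := dt_self_nonneg (sd b q j - τ c (sd b q i))
            have h4 := hF _ (hmem b j)
            have h5 : dt (τ c (sd b q i)) (τ c (sd b q i)) = m := by
              rw [← hF _ (hmem b i)]
              cases c
              · simp [τ, dt]
              · simp [τ]
            rw [h4, h5] at h1
            omega
      obtain ⟨g, hg, hgood⟩ := good_group hQ v hv hm hp J G (by rw [hcι]; exact hG)
      refine mem_biUnion.2 ⟨g, hg, ?_⟩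
      have hGT : ∀ b, ∀ i i', i ≠ i' →
          gdj (fun i => pr (g * J + i)) J (sd b q i) (sd b q i') := by
        intro b i i' hii k hk
        have e1 := hgood k hk ((i', i), b, true)
        have e2 := hgood k hk ((i', i), b, false)
        simp only [v, hii, if_false, τ, if_true] at e1 e2
        refine gd_of_not_dvd _ _ _ e1 ?_
        simpa using e2
      simp only [E, mem_filter, mem_product, GT]
      exact ⟨⟨⟨hq.1.1, hGT true⟩, ⟨hq.1.2, hGT false⟩⟩, hq.2⟩
  have h1 : en (t + 1) F = #({q ∈ tup (t + 1) F ×ˢ tup (t + 1) F |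
      ∑ l, q.1 l = ∑ l, q.2 l} : Finset ((Fin (t + 1) → Fin 3 → ℤ) × (Fin (t + 1) → Fin 3 → ℤ))) := by
    unfold en prs; congr
  rw [h1]
  refine (card_le_card hsub).trans ((card_union_le _ _).trans (add_le_add ?_ ?_))
  · refine card_biUnion_le.trans ((sum_le_card_nsmul _ _ _ fun x _ => hD x).trans ?_)
    rw [card_univ, hcι, smul_eq_mul]
  · refine card_biUnion_le.trans (sum_le_sum fun g _ => ?_)
    unfold prs
    apply le_of_eq
    simp only [E]

end split

theorem log_pow_bound (J : ℕ) (hJ : 1 ≤ J) (η : ℝ) (hη : 0 < η) : ∃ C : ℝ, 1 ≤ C ∧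
    ∀ m n : ℕ, 0 < m → 0 < n → n ≤ (2 * m + 1) ^ 3 → ∃ l : ℕ, 1 ≤ l ∧ n < 2 ^ l ∧
      (32 * (l : ℝ) ^ 4) ^ J ≤ C * (m : ℝ) ^ η := by
  have hJ' : (1 : ℝ) ≤ J := by exact_mod_cast hJ
  set θ : ℝ := η / (12 * J) with hθ
  have hθ0 : 0 < θ := by positivity
  refine ⟨(32 * (1 + 2 / θ) ^ 4) ^ J * (27 : ℝ) ^ (η / 3), ?_, ?_⟩
  · have h1 : (1 : ℝ) ≤ 1 + 2 / θ := by have : 0 < 2 / θ := by positivity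
                                        linarith
    have h2 : (1 : ℝ) ≤ (1 + 2 / θ) ^ 4 := one_le_pow₀ h1
    have h3 : (1 : ℝ) ≤ (32 * (1 + 2 / θ) ^ 4) ^ J := one_le_pow₀ (by linarith)
    have h4 : (1 : ℝ) ≤ (27 : ℝ) ^ (η / 3) := Real.one_le_rpow (by norm_num) (by positivity)
    nlinarith
  · intro m n hm hn hnm
    refine ⟨Nat.log 2 n + 1, by omega, Nat.lt_pow_succ_log_self (by norm_num) n, ?_⟩
    have hm1 : (1 : ℝ) ≤ m := by exact_mod_cast hm
    have hn1 : (1 : ℝ) ≤ n := by exact_mod_cast hn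
    have hn27 : (n : ℝ) ≤ 27 * (m : ℝ) ^ 3 := by
      have : (n : ℝ) ≤ (2 * m + 1) ^ 3 := by exact_mod_cast hnm
      refine this.trans ?_
      have : (2 * (m : ℝ) + 1) ^ 3 ≤ (3 * m) ^ 3 := by
        apply pow_le_pow_left₀ (by positivity); linarith
      calc _ ≤ _ := this
        _ = _ := by ring
    have hl : ((Nat.log 2 n : ℕ) : ℝ) ≤ 2 * Real.log n := by
      have h1 : (2 : ℝ) ^ (Nat.log 2 n) ≤ n := by
        exact_mod_cast Nat.pow_log_le_self 2 (by omega)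
      have h2 := Real.log_le_log (by positivity) h1
      rw [Real.log_pow] at h2
      have h3 := Real.log_two_gt_d9
      have h4 : (0 : ℝ) ≤ (Nat.log 2 n : ℕ) := by positivity
      nlinarith
    have hlog := Real.log_le_rpow_div (x := n) (by positivity) hθ0
    have hnθ : (1 : ℝ) ≤ (n : ℝ) ^ θ := Real.one_le_rpow hn1 hθ0.le
    have hlb : ((Nat.log 2 n + 1 : ℕ) : ℝ) ≤ (1 + 2 / θ) * (n : ℝ) ^ θ := by
      push_cast
      have : 2 * ((n : ℝ) ^ θ / θ) = 2 / θ * (n : ℝ) ^ θ := by ring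
      nlinarith
    have h5 : (32 * ((Nat.log 2 n + 1 : ℕ) : ℝ) ^ 4) ^ J ≤
        (32 * ((1 + 2 / θ) * (n : ℝ) ^ θ) ^ 4) ^ J := by
      gcongr
    refine h5.trans ?_
    have h6 : (32 * ((1 + 2 / θ) * (n : ℝ) ^ θ) ^ 4) ^ J =
        (32 * (1 + 2 / θ) ^ 4) ^ J * (n : ℝ) ^ (η / 3) := by
      have : (n : ℝ) ^ (η / 3) = (((n : ℝ) ^ θ) ^ 4) ^ J := by
        rw [← pow_mul, ← Real.rpow_natCast, ← Real.rpow_mul (by positivity)]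
        congr 1
        rw [hθ]; push_cast; field_simp; norm_num
      rw [this, ← mul_pow]
      congr 1
      ring
    rw [h6, mul_assoc]
    apply mul_le_mul_of_nonneg_left _ (by positivity)
    calc (n : ℝ) ^ (η / 3) ≤ (27 * (m : ℝ) ^ 3) ^ (η / 3) :=
          Real.rpow_le_rpow (by positivity) hn27 (by positivity)
      _ = 27 ^ (η / 3) * (m : ℝ) ^ η := by
          rw [Real.mul_rpow (by norm_num) (by positivity), ← Real.rpow_natCast (m : ℝ) 3,
            ← Real.rpow_mul (by positivity)]
          congr 2
          push_cast; ring

theorem card_sphere_le (m : ℕ) (F : Finset (Fin 3 → ℤ)) (hF : ∀ a ∈ F, dt a a = m) :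
    #F ≤ (2 * m + 1) ^ 3 := by
  have hsub : F ⊆ Fintype.piFinset (fun _ : Fin 3 => Icc (-(m : ℤ)) m) := by
    intro a ha
    rw [Fintype.mem_piFinset]
    intro c
    have h := hF a ha
    unfold dt at h
    have h0 := mul_self_nonneg (a 0)
    have h1 := mul_self_nonneg (a 1)
    have h2 := mul_self_nonneg (a 2)
    have hc : a c * a c ≤ m := by
      fin_cases c
      · change a 0 * a 0 ≤ _; linarith
      · change a 1 * a 1 ≤ _; linarith
      · change a 2 * a 2 ≤ _; linarith
    rw [mem_Icc]
    constructor <;> nlinarith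
  refine (card_le_card hsub).trans ?_
  rw [Fintype.card_piFinset]
  simp only [Int.card_Icc, prod_const, card_univ, Fintype.card_fin]
  apply Nat.pow_le_pow_left
  omega

set_option maxHeartbeats 2000000 in
theorem energy_k (u : ℕ) (ε : ℝ) (hε : 0 < ε) : ∃ W : ℝ, 1 ≤ W ∧
    ∀ m : ℕ, 0 < m → ∀ F : Finset (Fin 3 → ℤ), F.Nonempty → (∀ a ∈ F, dt a a = m) →
      ∀ k : ℝ, 1 ≤ k → k ≤ #F →
      (en (u + 3) F : ℝ) ≤ W * (m : ℝ) ^ ε * (k * ((#F : ℝ) * en (u + 2) F +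
        (#F : ℝ) ^ (2 * u) * (((#F : ℝ) / k) ^ (3 / 2 : ℝ) * ((#F : ℝ) * #F) ^ (5 / 4 : ℝ)))) := by
  obtain ⟨e, he⟩ := exists_nat_gt (9 / ε)
  have he0 : (0 : ℝ) < e := lt_trans (by positivity) he
  have he1 : e ≠ 0 := by rintro rfl; simp at he0
  obtain ⟨Cc, hCc1, hCc⟩ := circle_bound (ε / 3) (by positivity)
  obtain ⟨Cl, hCl1, hCl⟩ := log_pow_bound (e + 3) (by omega) (ε / 3) (by positivity)
  let G : ℕ := 4 * (u + 3) ^ 2 * (e + 2) + 1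
  let B : ℝ := 2 ^ (G * (e + 3))
  have hB1 : 1 ≤ B := one_le_pow₀ (by norm_num)
  let K : ℝ := 4 * ((u : ℝ) + 3) ^ 2 + G * (((u : ℝ) + 3) ^ 2 * ((e : ℝ) + 4) ^ 2)
  have hK1 : 1 ≤ K := by
    have : (0 : ℝ) ≤ G * (((u : ℝ) + 3) ^ 2 * ((e : ℝ) + 4) ^ 2) := by positivity
    have h2 : (0 : ℝ) ≤ u := by positivity
    simp only [K]; nlinarith
  refine ⟨K * ((B * 3) ^ 3 * Cc * Cl), ?_, ?_⟩
  · have h1 : (1 : ℝ) ≤ (B * 3) ^ 3 := one_le_pow₀ (by linarith)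
    have h2 := one_le_mul_of_one_le_of_one_le (one_le_mul_of_one_le_of_one_le h1 hCc1) hCl1
    exact one_le_mul_of_one_le_of_one_le hK1 h2
  intro m hm F hFne hF k hk hkn
  have hm1 : (1 : ℝ) ≤ m := by exact_mod_cast hm
  have hn0 : 0 < #F := hFne.card_pos
  have hn1 : (1 : ℝ) ≤ #F := by exact_mod_cast hn0
  let Q : ℕ := ⌈(m : ℝ) ^ (1 / (e : ℝ))⌉₊ + 1
  have hroot1 : (1 : ℝ) ≤ (m : ℝ) ^ (1 / (e : ℝ)) := Real.one_le_rpow hm1 (by positivity)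
  have hQ2 : 2 ≤ Q := by
    have : 0 < ⌈(m : ℝ) ^ (1 / (e : ℝ))⌉₊ := Nat.ceil_pos.2 (by linarith)
    simp only [Q]; omega
  have hQup : (Q : ℝ) ≤ 3 * (m : ℝ) ^ (1 / (e : ℝ)) := by
    have := Nat.ceil_lt_add_one (a := (m : ℝ) ^ (1 / (e : ℝ))) (by linarith)
    simp only [Q]; push_cast; linarith
  have hQe : m ≤ Q ^ e := by
    have h1 : (m : ℝ) ^ (1 / (e : ℝ)) ≤ Q := by
      have := Nat.le_ceil ((m : ℝ) ^ (1 / (e : ℝ)))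
      simp only [Q]; push_cast; linarith
    have h2 : ((m : ℝ) ^ (1 / (e : ℝ))) ^ e ≤ (Q : ℝ) ^ e := pow_le_pow_left₀ (by linarith) h1 e
    rw [one_div, Real.rpow_inv_natCast_pow (by positivity) he1] at h2
    exact_mod_cast h2
  have hmQ : 4 * m ≤ Q ^ (e + 2) := by
    rw [pow_add]
    have : 2 ^ 2 ≤ Q ^ 2 := Nat.pow_le_pow_left hQ2 2
    nlinarith
  obtain ⟨pr, hmono, hpr⟩ := prime_seq Q hQ2
  have hpr' : ∀ i, (pr i).Prime ∧ Q < pr i := fun i => ⟨(hpr i).1, (hpr i).2.1⟩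
  have hsplit := en_split (Q := Q) (T := e + 2) (m := m) hQ2 hmQ (Nat.one_le_pow _ _ (by omega))
    hmono hpr' F hF (u + 2) (e + 3) G (Nat.lt_succ_self _)
  obtain ⟨l, hl1, hnl, hlb⟩ := hCl m #F hm hn0 (card_sphere_le m F hF)
  have hlR : (1 : ℝ) ≤ (32 * (l : ℝ) ^ 4) ^ (e + 3) := by
    have h1 : (1 : ℝ) ≤ l := by exact_mod_cast hl1
    have h2 : (1 : ℝ) ≤ (l : ℝ) ^ 4 := one_le_pow₀ h1
    exact one_le_pow₀ (by linarith)
  let P : ℝ := B * Q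
  have hQ1 : (1 : ℝ) ≤ Q := by exact_mod_cast (by omega : 1 ≤ Q)
  have hP1 : 1 ≤ P := one_le_mul_of_one_le_of_one_le hB1 hQ1
  have hPup : P ≤ (B * 3) * (m : ℝ) ^ (1 / (e : ℝ)) := by
    simp only [P]
    rw [mul_assoc]
    exact mul_le_mul_of_nonneg_left hQup (by linarith)
  have hP3 : P ^ 3 ≤ (B * 3) ^ 3 * (m : ℝ) ^ (ε / 3) := by
    refine (pow_le_pow_left₀ (by linarith) hPup 3).trans ?_
    rw [mul_pow]
    apply mul_le_mul_of_nonneg_left _ (by positivity)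
    rw [← Real.rpow_natCast, ← Real.rpow_mul (by positivity)]
    apply Real.rpow_le_rpow_of_exponent_le hm1
    rw [div_lt_iff₀ hε] at he
    rw [one_div, inv_mul_le_iff₀ he0]
    push_cast
    linarith
  set CcM : ℝ := Cc * (m : ℝ) ^ (ε / 3) with hCcM
  have hme : (1 : ℝ) ≤ (m : ℝ) ^ (ε / 3) := Real.one_le_rpow hm1 (by positivity)
  have hCcM1 : 1 ≤ CcM := one_le_mul_of_one_le_of_one_le hCc1 hme
  set LL : ℝ := (32 * (l : ℝ) ^ 4) ^ (e + 3) with hLL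
  set a : ℝ := (#F : ℝ) * en (u + 2) F with ha
  set b : ℝ := (#F : ℝ) ^ (2 * u) * (((#F : ℝ) / k) ^ (3 / 2 : ℝ) * ((#F : ℝ) * #F) ^ (5 / 4 : ℝ))
    with hb
  have ha0 : 0 ≤ a := by positivity
  have hb0 : 0 ≤ b := by
    have : 0 ≤ (#F : ℝ) / k := by positivity
    positivity
  have hCb : 1 ≤ CcM * LL := one_le_mul_of_one_le_of_one_le hCcM1 hlR
  have hP31 : 1 ≤ P ^ 3 := one_le_pow₀ hP1
  have hgroup : ∀ g ∈ range G, (prs (GT (fun i => pr (g * (e + 3) + i)) F (e + 3) (u + 3))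
      (GT (fun i => pr (g * (e + 3) + i)) F (e + 3) (u + 3)) (fun X => ∑ i, X i)
      (fun X => ∑ i, X i) : ℝ) ≤
        (((u : ℝ) + 3) ^ 2 * ((e : ℝ) + 4) ^ 2) * ((P ^ 3 * (CcM * LL)) * (k * (a + b))) := by
    intro g hg
    have h1 := levels_main (fun i => pr (g * (e + 3) + i)) F (e + 3) m l u hl1 k P CcM hk hkn hP1
      (fun i => ⟨(hpr _).1, by have := (hpr (g * (e + 3) + i)).2.1; omega⟩)
      (by
        intro i hi
        have h2 : pr (g * (e + 3) + i) ≤ 2 ^ (G * (e + 3)) * Q := by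
          refine (hpr _).2.2.trans (Nat.mul_le_mul_right _ (Nat.pow_le_pow_right (by norm_num) ?_))
          have : g + 1 ≤ G := by simpa using hg
          nlinarith
        simp only [P, B]
        exact_mod_cast h2)
      (by
        intro x hx y hy h
        refine resid_sep (T := e + 2) hQ2 hmQ (p := fun i => pr (g * (e + 3) + i)) ?_
          (fun i => hpr' _) x y (hF x hx) (hF y hy) h
        intro i j hij
        exact hmono (by omega))
      hF hnl
      (by
        intro d hd
        exact hCc m hm d hd F (by
          intro x hx
          rw [← hF x hx, Fin.sum_univ_three]; unfold dt; ring))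
    refine h1.trans ?_
    have hin : (#F : ℝ) * en (u + 2) F + (((e + 3 : ℕ) : ℝ) + 1) * (CcM * ((#F : ℝ) ^ (2 * u) *
        ((32 * (l : ℝ) ^ 4) ^ (e + 3) * ((#F : ℝ) / k) ^ (3 / 2 : ℝ) *
          ((#F : ℝ) * #F) ^ (5 / 4 : ℝ)))) = a + (e + 4) * ((CcM * LL) * b) := by
      rw [ha, hb, hLL]; push_cast; ring
    rw [hin]
    have hin2 : a + (e + 4) * ((CcM * LL) * b) ≤ (e + 4) * ((CcM * LL) * (a + b)) := by
      have h3 : a ≤ (e + 4) * ((CcM * LL) * a) := by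
        rw [← mul_assoc]
        exact le_mul_of_one_le_left ha0
          (one_le_mul_of_one_le_of_one_le (by linarith) hCb)
      linarith
    have : ((u : ℝ) + 3) * ((((e + 3 : ℕ) : ℝ) + 1) * (k * P ^ 3)) *
        ((u + 3) * (a + (e + 4) * ((CcM * LL) * b))) ≤
        ((u : ℝ) + 3) * ((((e + 3 : ℕ) : ℝ) + 1) * (k * P ^ 3)) *
        ((u + 3) * ((e + 4) * ((CcM * LL) * (a + b)))) := by
      gcongr
    refine this.trans (le_of_eq ?_)
    push_cast; ring
  have hsR : (en (u + 3) F : ℝ) ≤ 4 * ((u : ℝ) + 3) ^ 2 * a + ∑ g ∈ range G,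
      (prs (GT (fun i => pr (g * (e + 3) + i)) F (e + 3) (u + 3))
      (GT (fun i => pr (g * (e + 3) + i)) F (e + 3) (u + 3)) (fun X => ∑ i, X i)
      (fun X => ∑ i, X i) : ℝ) := by
    have : (en (u + 3) F : ℝ) ≤ ((4 * (u + 2 + 1) ^ 2 * (#F * en (u + 2) F) +
      ∑ g ∈ range G, prs (GT (fun i => pr (g * (e + 3) + i)) F (e + 3) (u + 2 + 1))
        (GT (fun i => pr (g * (e + 3) + i)) F (e + 3) (u + 2 + 1)) (fun X => ∑ i, X i)
        (fun X => ∑ i, X i) : ℕ) : ℝ) := by exact_mod_cast hsplit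
    refine this.trans (le_of_eq ?_)
    rw [ha]; push_cast; ring
  have hs2 := hsR.trans (add_le_add_right (sum_le_card_nsmul _ _ _ hgroup) _)
  rw [card_range, nsmul_eq_mul] at hs2
  set Z : ℝ := P ^ 3 * (CcM * LL) with hZ
  have hZ1 : 1 ≤ Z := one_le_mul_of_one_le_of_one_le hP31 hCb
  have hab : a ≤ Z * (k * (a + b)) := by
    have h1 : a + b ≤ Z * (k * (a + b)) := by
      rw [← mul_assoc]
      exact le_mul_of_one_le_left (by linarith) (one_le_mul_of_one_le_of_one_le hZ1 hk)
    linarith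
  have hs3 : (en (u + 3) F : ℝ) ≤ K * (Z * (k * (a + b))) := by
    refine hs2.trans ?_
    have : 4 * ((u : ℝ) + 3) ^ 2 * a ≤ 4 * ((u : ℝ) + 3) ^ 2 * (Z * (k * (a + b))) := by
      gcongr
    simp only [K]; linarith
  have hZup : Z ≤ (B * 3) ^ 3 * Cc * Cl * (m : ℝ) ^ ε := by
    have hmm : (m : ℝ) ^ ε = (m : ℝ) ^ (ε / 3) * (m : ℝ) ^ (ε / 3) * (m : ℝ) ^ (ε / 3) := by
      rw [← Real.rpow_add (by linarith), ← Real.rpow_add (by linarith)]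
      congr 1; ring
    calc Z ≤ ((B * 3) ^ 3 * (m : ℝ) ^ (ε / 3)) * (CcM * (Cl * (m : ℝ) ^ (ε / 3))) := by
          rw [hZ]; gcongr
      _ = _ := by rw [hmm, hCcM]; ring
  refine hs3.trans ?_
  have hk0 : 0 ≤ k * (a + b) := by positivity
  calc K * (Z * (k * (a + b))) ≤
      K * (((B * 3) ^ 3 * Cc * Cl * (m : ℝ) ^ ε) * (k * (a + b))) := by gcongr
    _ = _ := by ring

theorem final_num (u : ℕ) (n E : ℝ) (hn : 1 ≤ n) (hE : 1 ≤ E) :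
    ((n ^ (2 * u + 3) / E) ^ (2 / 3 : ℝ)) * (n * E) =
      n ^ ((4 * ((u : ℝ) + 3) - 3) / 3) * E ^ (1 / 3 : ℝ) ∧
    ((n ^ (2 * u + 3) / E) ^ (2 / 3 : ℝ)) * (n ^ (2 * u) *
      ((n / (n ^ (2 * u + 3) / E) ^ (2 / 3 : ℝ)) ^ (3 / 2 : ℝ) * (n * n) ^ (5 / 4 : ℝ))) =
      n ^ ((4 * ((u : ℝ) + 3) - 3) / 3) * E ^ (1 / 3 : ℝ) := by
  obtain ⟨x, rfl⟩ : ∃ x, n = Real.exp x := ⟨Real.log n, (Real.exp_log (by linarith)).symm⟩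
  obtain ⟨y, rfl⟩ : ∃ y, E = Real.exp y := ⟨Real.log E, (Real.exp_log (by linarith)).symm⟩
  constructor
  · simp only [← Real.exp_nat_mul, ← Real.exp_sub, ← Real.exp_add, ← Real.exp_mul]
    congr 1; push_cast; ring
  · simp only [← Real.exp_nat_mul, ← Real.exp_sub, ← Real.exp_add, ← Real.exp_mul]
    congr 1; push_cast; ring

theorem energy_main (u : ℕ) (ε : ℝ) (hε : 0 < ε) : ∃ W : ℝ, 1 ≤ W ∧
    ∀ m : ℕ, 0 < m → ∀ F : Finset (Fin 3 → ℤ), F.Nonempty → (∀ a ∈ F, dt a a = m) →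
      (en (u + 3) F : ℝ) ≤ W * (m : ℝ) ^ ε *
        ((#F : ℝ) ^ ((4 * ((u : ℝ) + 3) - 3) / 3) * (en (u + 2) F : ℝ) ^ (1 / 3 : ℝ)) := by
  obtain ⟨W, hW1, hW⟩ := energy_k u ε hε
  refine ⟨2 * W, by linarith, ?_⟩
  intro m hm F hFne hF
  have hm1 : (1 : ℝ) ≤ m := by exact_mod_cast hm
  have hme : (1 : ℝ) ≤ (m : ℝ) ^ ε := Real.one_le_rpow hm1 (by positivity)
  have hn1 : (1 : ℝ) ≤ #F := by exact_mod_cast hFne.card_pos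
  have hE1 : (1 : ℝ) ≤ en (u + 2) F := by exact_mod_cast en_pos (u + 2) F hFne
  have hEle : (en (u + 2) F : ℝ) ≤ (#F : ℝ) ^ (2 * u + 3) := by
    have := en_le (u + 1) F
    rw [show 2 * (u + 1) + 1 = 2 * u + 3 by ring] at this
    exact_mod_cast this
  obtain ⟨h1, h2⟩ := final_num u _ _ hn1 hE1
  set k : ℝ := ((#F : ℝ) ^ (2 * u + 3) / (en (u + 2) F : ℝ)) ^ (2 / 3 : ℝ) with hk
  set R : ℝ := (#F : ℝ) ^ ((4 * ((u : ℝ) + 3) - 3) / 3) * (en (u + 2) F : ℝ) ^ (1 / 3 : ℝ) with hR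
  have hk1 : 1 ≤ k := Real.one_le_rpow ((one_le_div (by linarith)).2 hEle) (by norm_num)
  have hR0 : 0 ≤ R := by positivity
  by_cases hkn : k ≤ #F
  · refine (hW m hm F hFne hF k hk1 hkn).trans ?_
    rw [mul_add, h1, h2]
    apply le_of_eq; ring
  · push Not at hkn
    have h3 : (en (u + 3) F : ℝ) ≤ (#F : ℝ) ^ 2 * en (u + 2) F := by
      exact_mod_cast en_succ_le (u + 2) F
    have h4 : (#F : ℝ) ^ 2 * en (u + 2) F ≤ R := by
      rw [← h1, sq, mul_assoc]
      gcongr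
    refine (h3.trans h4).trans ?_
    exact le_mul_of_one_le_left hR0 (one_le_mul_of_one_le_of_one_le (by linarith) hme)

theorem addEnergy_coe (s : ℕ) (F : Finset (Fin 3 → ℤ)) :
    addEnergy s (F : Set (Fin 3 → ℤ)) = en s F := by
  unfold _root_.addEnergy en prs
  apply Nat.subtype_card
  intro p
  simp [mem_tup, and_assoc]

theorem statement_15 (s : ℕ) (hs : 3 ≤ s) (ε : ℝ) (hε : 0 < ε) :
    ∃ C : ℝ, 0 < C ∧
      ∀ m : ℕ, 0 < m → ∀ A : Set (Fin 3 → ℤ), A.Finite → A.Nonempty → A ⊆ latSphere 3 m →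
        (addEnergy s A : ℝ) ≤ C * (m : ℝ) ^ ε *
          ((A.ncard : ℝ) ^ ((4 * (s : ℝ) - 3) / 3) * (addEnergy (s - 1) A : ℝ) ^ ((1 : ℝ) / 3) +
            (A.ncard : ℝ) ^ (2 * (s : ℝ) - 3)) := by
  obtain ⟨u, rfl⟩ : ∃ u, s = u + 3 := ⟨s - 3, by omega⟩
  obtain ⟨W, hW1, hW⟩ := energy_main u ε hε
  refine ⟨W, by linarith, ?_⟩
  intro m hm A hAf hAne hA
  obtain ⟨F, rfl⟩ : ∃ F : Finset (Fin 3 → ℤ), A = F := ⟨hAf.toFinset, by simp⟩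
  have hF : ∀ a ∈ F, dt a a = m := by
    intro a ha
    have h : ∑ i, a i ^ 2 = (m : ℤ) := hA ha
    rw [Fin.sum_univ_three] at h
    rw [← h]; unfold dt; ring
  have h := hW m hm F (by simpa using hAne) hF
  rw [show u + 3 - 1 = u + 2 by omega, addEnergy_coe, addEnergy_coe, Set.ncard_coe_finset]
  push_cast
  refine h.trans ?_
  have h0 : (0 : ℝ) ≤ (#F : ℝ) ^ (2 * ((u : ℝ) + 3) - 3) := by positivity
  have h1 : (0 : ℝ) ≤ W * (m : ℝ) ^ ε := by positivity
  apply mul_le_mul_of_nonneg_left _ h1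
  linarith
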